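/- arXiv:math/0603055 — 4 statements merged into one kernel-verified Lean document; each statement's English description precedes it below -/
import Mathlib

section
/- Suppose a countable group Γ, equipped with a proper left invariant metric, acts by isometries on a geodesic metric space X. Let x₀ ∈ X and n ∈ ℕ, and suppose that for every R > 0 the R-stabilizer W_R(x₀) = { g ∈ Γ : d_X(g·x₀, x₀) ≤ R }, with the metric restricted from Γ, satisfies asdim W_R(x₀) ≤ n. Then asdim Γ ≤ n + asdim X. -/
/-- A family `𝒰` of subsets of a metric space is `d`-disjoint if any two points lying in
distinct members of `𝒰` are at distance greater than `d`. -/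
def DDisjoint {X : Type*} [MetricSpace X] (d : ℝ) (𝒰 : Set (Set X)) : Prop :=
  ∀ U ∈ 𝒰, ∀ V ∈ 𝒰, U ≠ V → ∀ x ∈ U, ∀ y ∈ V, d < dist x y

/-- A family `𝒰` of subsets of a metric space is `R`-bounded if every member has
diameter at most `R`. -/
def RBounded {X : Type*} [MetricSpace X] (R : ℝ) (𝒰 : Set (Set X)) : Prop :=
  ∀ U ∈ 𝒰, ∀ x ∈ U, ∀ y ∈ U, dist x y ≤ R

/-- `AsdimLE X n` : the metric space `X` has asymptotic dimension at most `n`, i.e. for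
every `d > 0` there are `R > 0` and `n+1` families of subsets of `X`, each `R`-bounded and
`d`-disjoint, whose union covers `X`. -/
def AsdimLE (X : Type*) [MetricSpace X] (n : ℕ) : Prop :=
  ∀ d : ℝ, 0 < d → ∃ R : ℝ, 0 < R ∧ ∃ 𝒰 : Fin (n + 1) → Set (Set X),
    (∀ i, RBounded R (𝒰 i)) ∧ (∀ i, DDisjoint d (𝒰 i)) ∧ (⋃ i, ⋃₀ 𝒰 i) = Set.univ

/-- The asymptotic dimension of a metric space, as an element of `ℕ∞`: the least `n` such
that `AsdimLE X n` holds, or `⊤` if there is no such `n`. -/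
noncomputable def asdim (X : Type*) [MetricSpace X] : ℕ∞ :=
  sInf {m : ℕ∞ | ∃ n : ℕ, m = (n : ℕ∞) ∧ AsdimLE X n}


/-- One step of an `r`-chain inside `S`. -/
def ChStep {X : Type*} [MetricSpace X] (S : Set X) (r : ℝ) (a b : X) : Prop :=
  a ∈ S ∧ b ∈ S ∧ dist a b ≤ r

/-- `r`-chains inside `S`. -/
def Ch {X : Type*} [MetricSpace X] (S : Set X) (r : ℝ) : X → X → Prop :=
  Relation.ReflTransGen (ChStep S r)

/-- `r`-chains in `S` have endpoints at distance at most `R`. -/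
def Sc {X : Type*} [MetricSpace X] (r R : ℝ) (S : Set X) : Prop :=
  ∀ x y, Ch S r x y → dist x y ≤ R

lemma Ch.symm {X : Type*} [MetricSpace X] {S : Set X} {r : ℝ} {x y : X} (h : Ch S r x y) :
    Ch S r y x := by
  induction h with
  | refl => exact Relation.ReflTransGen.refl
  | tail _ h2 ih =>
    exact Relation.ReflTransGen.head ⟨h2.2.1, h2.1, by rw [dist_comm]; exact h2.2.2⟩ ih

lemma Ch.mono {X : Type*} [MetricSpace X] {S S' : Set X} {r r' : ℝ} {x y : X} (h : Ch S r x y)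
    (hS : S ⊆ S') (hr : r ≤ r') : Ch S' r' x y := by
  induction h with
  | refl => exact Relation.ReflTransGen.refl
  | tail _ h2 ih =>
    exact Relation.ReflTransGen.tail ih ⟨hS h2.1, hS h2.2.1, h2.2.2.trans hr⟩

lemma Sc.mono {X : Type*} [MetricSpace X] {S S' : Set X} {r r' R R' : ℝ} (h : Sc r R S)
    (hS : S' ⊆ S) (hr : r' ≤ r) (hR : R ≤ R') : Sc r' R' S' :=
  fun x y hc => (h x y (hc.mono hS hr)).trans hR

lemma Ch.mem_of_mem {X : Type*} [MetricSpace X] {S : Set X} {r : ℝ} {x y : X}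
    (h : Ch S r x y) (hx : x ∈ S) : y ∈ S := by
  induction h with
  | refl => exact hx
  | tail _ h2 _ => exact h2.2.1

lemma exists_rep {X : Type*} [MetricSpace X] (S : Set X) (r : ℝ) :
    ∃ rp : X → X, (∀ x, Ch S r x (rp x)) ∧ ∀ x y, Ch S r x y → rp x = rp y := by
  let st : Setoid X := ⟨Ch S r, fun _ => Relation.ReflTransGen.refl, fun h => h.symm,
    fun h1 h2 => Relation.ReflTransGen.trans h1 h2⟩
  refine ⟨fun x => (Quotient.mk st x).out, fun x => ?_, fun x y h => ?_⟩
  · have : st ((Quotient.mk st x).out) x := Quotient.mk_out x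
    exact Ch.symm this
  · have : Quotient.mk st x = Quotient.mk st y := Quotient.sound h
    simp only [this]

lemma sc_of_family {X : Type*} [MetricSpace X] {d R : ℝ} (hR : 0 ≤ R) (U : Set (Set X))
    (hb : RBounded R U) (hd : DDisjoint d U) : Sc d R (⋃₀ U) := by
  intro x y h
  have : x = y ∨ ∃ V ∈ U, x ∈ V ∧ y ∈ V := by
    induction h with
    | refl => exact Or.inl rfl
    | @tail b c h1 h2 ih =>
      right
      obtain ⟨⟨V, hV, hbV⟩, ⟨V', hV', hcV'⟩, hdist⟩ := h2
      have hVV : V = V' := by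
        by_contra hne
        exact absurd hdist (not_le.mpr (hd V hV V' hV' hne b hbV c hcV'))
      subst hVV
      rcases ih with rfl | ⟨V2, hV2, hx2, hb2⟩
      · exact ⟨V, hV, hbV, hcV'⟩
      · have : V2 = V := by
          by_contra hne
          have h0 := hd V2 hV2 V hV hne b hb2 c hcV'
          linarith
        subst this
        exact ⟨V2, hV2, hx2, hcV'⟩
  rcases this with rfl | ⟨V, hV, hx, hy⟩
  · simpa using hR
  · exact hb V hV x hx y hy

lemma asdimLE_of_sc {X : Type*} [MetricSpace X] {n : ℕ}
    (h : ∀ d : ℝ, 0 < d → ∃ R : ℝ, ∃ E : ℕ → Set X, (∀ i < n + 1, Sc d R (E i)) ∧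
      ∀ x, ∃ i < n + 1, x ∈ E i) : AsdimLE X n := by
  intro d hd
  obtain ⟨R, E, hE, hcov⟩ := h d hd
  refine ⟨max R 1, by positivity, fun i => {V | ∃ x ∈ E i, V = {y | Ch (E i) d x y}}, ?_, ?_, ?_⟩
  · rintro i V ⟨x, hx, rfl⟩ y hy z hz
    exact (hE i i.2 y z (Relation.ReflTransGen.trans (Ch.symm hy) hz)).trans (le_max_left _ _)
  · rintro i V ⟨x, hx, rfl⟩ V' ⟨x', hx', rfl⟩ hne y hy z hz
    by_contra hcon
    push Not at hcon
    apply hne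
    have hyz : Ch (E i) d y z := Relation.ReflTransGen.single
      ⟨Ch.mem_of_mem hy hx, Ch.mem_of_mem hz hx', hcon⟩
    have hxx : Ch (E i) d x x' :=
      Relation.ReflTransGen.trans hy (Relation.ReflTransGen.trans hyz (Ch.symm hz))
    ext w
    exact ⟨fun hw => Relation.ReflTransGen.trans hxx.symm hw,
      fun hw => Relation.ReflTransGen.trans hxx hw⟩
  · rw [Set.eq_univ_iff_forall]
    intro x
    obtain ⟨i, hi, hx⟩ := hcov x
    refine Set.mem_iUnion.mpr ⟨⟨i, hi⟩, ?_⟩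
    exact ⟨_, ⟨x, hx, rfl⟩, Relation.ReflTransGen.refl⟩

/-- Lifting chains from a neighbourhood. -/
lemma lift_chain {Y X : Type*} [MetricSpace Y] [MetricSpace X] (f : Y → X) (W : Set X)
    {r ρ L R : ℝ} (hL : 0 ≤ L) (hR : 0 ≤ R)
    (hf : ∀ a b, dist a b ≤ r → dist (f a) (f b) ≤ ρ)
    (hW : Sc (ρ + 2 * L) R W) (x y : Y)
    (h : Ch {g | ∃ w ∈ W, dist (f g) w ≤ L} r x y) : dist (f x) (f y) ≤ R + 2 * L := by
  have key : x = y ∨ ∃ v w, v ∈ W ∧ w ∈ W ∧ dist (f x) v ≤ L ∧ dist (f y) w ≤ L ∧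
      Ch W (ρ + 2 * L) v w := by
    induction h with
    | refl => exact Or.inl rfl
    | @tail b c h1 h2 ih =>
      right
      obtain ⟨⟨v, hv, hbv⟩, ⟨w, hw, hcw⟩, hdist⟩ := h2
      have hbc := hf _ _ hdist
      have aux : ∀ u, dist (f b) u ≤ L → dist u w ≤ ρ + 2 * L := by
        intro u hu
        have h1 := dist_triangle u (f b) w
        have h2 := dist_triangle (f b) (f c) w
        rw [dist_comm u (f b)] at h1
        linarith
      rcases ih with rfl | ⟨v', w', hv', hw', hxv, hbw, hch⟩
      · exact ⟨v, w, hv, hw, hbv, hcw, Relation.ReflTransGen.single ⟨hv, hw, aux v hbv⟩⟩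
      · exact ⟨v', w, hv', hw, hxv, hcw, Relation.ReflTransGen.tail hch ⟨hw', hw, aux w' hbw⟩⟩
  rcases key with rfl | ⟨v, w, hv, hw, hxv, hyw, hch⟩
  · rw [dist_self]; linarith
  · have := hW _ _ hch
    have h1 := dist_triangle (f x) v (f y)
    have h2 := dist_triangle v w (f y)
    rw [dist_comm w] at h2
    linarith

/-- Chains in the set of points lying in exactly `n` of the missing sets have constant type. -/
lemma type_chain {X : Type*} [MetricSpace X] (I : Finset ℕ) (Ms Mb : ℕ → Set X) (n : ℕ)
    (pred : Finset ℕ → Prop) {δ : ℝ} (hδ : 0 ≤ δ)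
    (h1 : ∀ a ∈ I, ∀ x x', x' ∈ Ms a → dist x x' ≤ δ → x ∈ Mb a)
    (h2 : ∀ T ⊆ I, ∀ x, (∀ a ∈ T, x ∈ Mb a) → T.card ≤ n)
    (P : Set X) (hP : ∀ x ∈ P, ∃ T ⊆ I, T.card = n ∧ pred T ∧ ∀ a ∈ T, x ∈ Ms a)
    (x y : X) (h : Ch P δ x y) :
    x = y ∨ ∃ T ⊆ I, T.card = n ∧ pred T ∧ Ch {z | ∀ a ∈ T, z ∈ Ms a} δ x y := by
  have hsb : ∀ a ∈ I, ∀ x, x ∈ Ms a → x ∈ Mb a := fun a ha x hx => h1 a ha x x hx (by simpa using hδ)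
  have key : ∀ T ⊆ I, T.card = n → ∀ T' ⊆ I, T'.card = n → ∀ u v, dist u v ≤ δ →
      (∀ a ∈ T, u ∈ Ms a) → (∀ a ∈ T', v ∈ Ms a) → T' = T := by
    intro T hT hTc T' hT' hTc' u v huv hu hv
    apply Finset.eq_of_subset_of_card_le _ (by omega)
    intro a ha
    by_contra hna
    have := h2 (insert a T) (Finset.insert_subset (hT' ha) hT) u (by
      intro b hb
      rcases Finset.mem_insert.mp hb with rfl | hb
      · exact h1 b (hT' ha) u v (hv b ha) huv
      · exact hsb b (hT hb) u (hu b hb))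
    rw [Finset.card_insert_of_notMem hna] at this
    omega
  have : x = y ∨ ∃ T ⊆ I, T.card = n ∧ pred T ∧ (∀ a ∈ T, y ∈ Ms a) ∧
      Ch {z | ∀ a ∈ T, z ∈ Ms a} δ x y := by
    induction h with
    | refl => exact Or.inl rfl
    | @tail b c hb hbc ih =>
      right
      obtain ⟨T', hT', hc', hp', hm'⟩ := hP c hbc.2.1
      rcases ih with rfl | ⟨T, hT, hc, hp, hm, hch⟩
      · obtain ⟨T, hT, hc, hp, hm⟩ := hP x hbc.1
        have := key T hT hc T' hT' hc' x c hbc.2.2 hm hm'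
        subst this
        exact ⟨T', hT, hc, hp, hm', Relation.ReflTransGen.single ⟨hm, hm', hbc.2.2⟩⟩
      · have := key T hT hc T' hT' hc' b c hbc.2.2 hm hm'
        subst this
        exact ⟨T', hT, hc, hp, hm', Relation.ReflTransGen.tail hch ⟨hm, hm', hbc.2.2⟩⟩
  rcases this with h | ⟨T, a, b, c, _, e⟩
  · exact Or.inl h
  · exact Or.inr ⟨T, a, b, c, e⟩

lemma sc_nbhd {X : Type*} [MetricSpace X] {δ R : ℝ} (hδ : 0 ≤ δ) (hR : 0 ≤ R) {A : Set X}
    (h : Sc (3 * δ) R A) : Sc δ (R + 2 * δ) {x | ∃ w ∈ A, dist x w ≤ δ} := by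
  intro x y hc
  exact lift_chain id A (ρ := δ) hδ hR (fun a b h => h) (by convert h using 1; ring) x y hc

/-- Kolmogorov trick. -/
lemma kolmogorov {X : Type*} [MetricSpace X] {n : ℕ} (hX : AsdimLE X n) (q : ℕ) :
    ∀ d : ℝ, 0 < d → ∃ R : ℝ, 0 ≤ R ∧ ∃ A : ℕ → Set X, (∀ i < n + 1 + q, Sc d R (A i)) ∧
      ∀ T ⊆ Finset.range (n + 1 + q), ∀ x, (∀ i ∈ T, x ∉ A i) → T.card ≤ n := by
  induction q with
  | zero =>
    intro d hd
    obtain ⟨R, hR, U, hb, hdj, hcov⟩ := hX d hd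
    refine ⟨R, hR.le, fun i => if h : i < n + 1 then ⋃₀ (U ⟨i, h⟩) else ∅, ?_, ?_⟩
    · intro i hi
      have hi' : i < n + 1 := hi
      simp only [hi', dif_pos]
      exact sc_of_family hR.le _ (hb _) (hdj _)
    · intro T hT x hx
      have hxu : x ∈ (⋃ i, ⋃₀ U i) := by rw [hcov]; trivial
      obtain ⟨i, hi⟩ := Set.mem_iUnion.mp hxu
      have hiT : (i : ℕ) ∉ T := by
        intro h
        apply hx _ h
        simpa [i.2] using hi
      have : T ⊂ Finset.range (n + 1) := by
        refine ⟨hT, fun hh => hiT (hh (Finset.mem_range.mpr i.2))⟩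
      have := Finset.card_lt_card this
      simp at this
      omega
  | succ q ih =>
    intro d hd
    obtain ⟨R, hR, A, hA, hM⟩ := ih (3 * d) (by positivity)
    set K := n + 1 + q with hK
    let N : ℕ → Set X := fun i => {x | ∃ w ∈ A i, dist x w ≤ d}
    let P : Set X := {x | ∃ T ⊆ Finset.range K, T.card = n ∧ True ∧ ∀ a ∈ T, x ∈ (N a)ᶜ}
    have hAN : ∀ i, A i ⊆ N i := fun i x hx => ⟨x, hx, by simpa using hd.le⟩
    refine ⟨R + 2 * d, by positivity, fun i => if i < K then N i else P, ?_, ?_⟩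
    · intro i hi
      by_cases hiK : i < K
      · simp only [hiK, if_true]
        exact sc_nbhd hd.le hR (hA i hiK)
      · simp only [hiK, if_false]
        intro x y hxy
        have := type_chain (Finset.range K) (fun a => (N a)ᶜ) (fun a => (A a)ᶜ) n (fun _ => True)
          hd.le (fun a _ x x' hx' hdist hx => hx' ⟨x, hx, by rw [dist_comm]; exact hdist⟩)
          (fun T hT x hx => hM T hT x hx) P (fun x hx => hx) x y hxy
        rcases this with rfl | ⟨T, hT, hTc, -, hch⟩
        · rw [dist_self]; positivity
        · obtain ⟨i', hi', hi'T⟩ : ∃ i' ∈ Finset.range K, i' ∉ T := by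
            by_contra hcon
            push Not at hcon
            have := Finset.card_le_card hcon
            simp at this
            omega
          have hsub : {z | ∀ a ∈ T, z ∈ (N a)ᶜ} ⊆ A i' := by
            intro z hz
            by_contra hzA
            have := hM (insert i' T) (Finset.insert_subset hi' hT) z (by
              intro b hb
              rcases Finset.mem_insert.mp hb with rfl | hb
              · exact hzA
              · exact fun h => hz b hb (hAN b h))
            rw [Finset.card_insert_of_notMem hi'T] at this
            omega
          have := hA i' (Finset.mem_range.mp hi') x y (hch.mono hsub (by linarith))
          linarith
    · intro T hT x hx
      by_contra hcard
      push Not at hcard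
      have hT0 : (T.erase K) ⊆ Finset.range K := by
        intro a ha
        have h1 := Finset.mem_range.mp (hT (Finset.mem_of_mem_erase ha))
        have h2 := Finset.ne_of_mem_erase ha
        simp; omega
      have hx0 : ∀ a ∈ T.erase K, x ∉ N a := by
        intro a ha
        have h1 := Finset.mem_range.mp (hT0 ha)
        have := hx a (Finset.mem_of_mem_erase ha)
        simpa only [h1, if_true] using this
      have hc0 := hM _ hT0 x (fun a ha h => hx0 a ha (hAN a h))
      have hKT : K ∈ T := by
        by_contra h
        rw [Finset.erase_eq_of_notMem h] at hc0
        omega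
      have hcc := Finset.card_erase_of_mem hKT
      have := hx K hKT
      simp only [lt_irrefl, if_false] at this
      exact this ⟨T.erase K, hT0, by omega, trivial, hx0⟩

/-- Points whose closed `t`-ball lies in `S`. -/
def Shr {X : Type*} [MetricSpace X] (t : ℝ) (S : Set X) : Set X :=
  {x | ∀ y, dist x y ≤ t → y ∈ S}

/-- `s`-chains in `C` staying in one `r`-component of `Z`. -/
def CC {X : Type*} [MetricSpace X] (Z : Set X) (r : ℝ) (C : Set X) (s : ℝ) : X → X → Prop :=
  Relation.ReflTransGen (fun a b => a ∈ C ∧ b ∈ C ∧ dist a b ≤ s ∧ Ch Z r a b)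

/-- Saturated union. -/
lemma sc_saturated {X : Type*} [MetricSpace X] (Z C P : Set X) {r δ s S R : ℝ}
    (hδ : 0 ≤ δ) (hδr : δ ≤ r) (hC : C ⊆ Z) (hPZ : P ⊆ Z) (hS : 0 ≤ S) (hs : S + 2 * δ ≤ s)
    (hP : Sc δ S P) (hR : 0 ≤ R) (hCC : ∀ x y, CC Z r C s x y → dist x y ≤ R) :
    Sc δ (2 * S + R + 2 * δ) (C ∪ P) := by
  intro x y h
  have key : x = y ∨ (Ch P δ x y ∧ y ∈ P) ∨ ∃ c0 c, c0 ∈ C ∧ c ∈ C ∧ dist x c0 ≤ S + δ ∧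
      CC Z r C s c0 c ∧ (c = y ∨ ∃ y0, y0 ∈ P ∧ y ∈ P ∧ dist c y0 ≤ δ ∧ Ch P δ y0 y) := by
    induction h with
    | refl => exact Or.inl rfl
    | @tail b z hb hbz ih =>
      right
      obtain ⟨hbm, hzm, hd⟩ := hbz
      have ih' : (Ch P δ x b ∧ b ∈ P) ∨ ∃ c0 c, c0 ∈ C ∧ c ∈ C ∧ dist x c0 ≤ S + δ ∧
          CC Z r C s c0 c ∧ (c = b ∨ ∃ y0, y0 ∈ P ∧ b ∈ P ∧ dist c y0 ≤ δ ∧ Ch P δ y0 b) := by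
        rcases ih with rfl | ih
        · rcases hbm with hx | hx
          · right
            exact ⟨x, x, hx, hx, by rw [dist_self]; positivity, Relation.ReflTransGen.refl, Or.inl rfl⟩
          · left
            exact ⟨Relation.ReflTransGen.refl, hx⟩
        · exact ih
      rcases hzm with hz | hz
      · right
        rcases ih' with ⟨h1, h2⟩ | ⟨c0, c, hc0, hc, hd0, hcc, hend⟩
        · refine ⟨z, z, hz, hz, ?_, Relation.ReflTransGen.refl, Or.inl rfl⟩
          have := hP _ _ h1
          have := dist_triangle x b z
          linarith
        · refine ⟨c0, z, hc0, hz, hd0, ?_, Or.inl rfl⟩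
          rcases hend with rfl | ⟨y0, hy0, hbP, hd1, hch⟩
          · exact Relation.ReflTransGen.tail hcc ⟨hc, hz, by linarith,
              Relation.ReflTransGen.single ⟨hC hc, hC hz, by linarith⟩⟩
          · refine Relation.ReflTransGen.tail hcc ⟨hc, hz, ?_, ?_⟩
            · have h1 := hP _ _ hch
              have h2 := dist_triangle c y0 z
              have h3 := dist_triangle y0 b z
              linarith
            · refine Relation.ReflTransGen.head ⟨hC hc, hPZ hy0, by linarith⟩ ?_
              exact Relation.ReflTransGen.tail (hch.mono hPZ hδr) ⟨hPZ hbP, hC hz, by linarith⟩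
      · rcases ih' with ⟨h1, h2⟩ | ⟨c0, c, hc0, hc, hd0, hcc, hend⟩
        · exact Or.inl ⟨Relation.ReflTransGen.tail h1 ⟨h2, hz, hd⟩, hz⟩
        · right
          refine ⟨c0, c, hc0, hc, hd0, hcc, Or.inr ?_⟩
          rcases hend with rfl | ⟨y0, hy0, hbP, hd1, hch⟩
          · exact ⟨z, hz, hz, hd, Relation.ReflTransGen.refl⟩
          · exact ⟨y0, hy0, hz, hd1, Relation.ReflTransGen.tail hch ⟨hbP, hz, hd⟩⟩
  rcases key with rfl | ⟨h1, h2⟩ | ⟨c0, c, hc0, hc, hd0, hcc, hend⟩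
  · rw [dist_self]; positivity
  · have := hP _ _ h1
    linarith
  · have h1 := hCC _ _ hcc
    have h2 := dist_triangle x c0 c
    rcases hend with rfl | ⟨y0, hy0, hbP, hd1, hch⟩
    · linarith
    · have h3 := hP _ _ hch
      have h4 := dist_triangle x c y
      have h5 := dist_triangle c y0 y
      linarith

/-- The main induction. -/
lemma stages {X : Type*} [MetricSpace X] {n k : ℕ} (hk : n + 1 ≤ k) {r : ℝ}
    (Z : ℕ → Set X) (C : ℕ → ℕ → Set X) (S R : ℕ → ℝ) (hR : ∀ j, 0 ≤ R j)
    (hS0 : 0 ≤ S 0) (hS : ∀ j, S (j + 1) = 2 * S j + R j + 3 * r)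
    (hC : ∀ j i, C j i ⊆ Z j)
    (hCn : ∀ j, ∀ T ⊆ Finset.range k, ∀ x ∈ Z j, (∀ i ∈ T, x ∉ C j i) → T.card ≤ n)
    (hCC : ∀ j, ∀ i < k, ∀ x y, CC (Z j) r (C j i) (S j + 2 * r) x y → dist x y ≤ R j) (p : ℕ) :
    ∀ δ : ℝ, 0 < δ → 3 ^ p * δ = r → ∃ A : ℕ → Set X,
      (∀ a < p, Sc δ (S (a / k + 1) - δ) (A a)) ∧
      (∀ T ⊆ Finset.range p, ∀ x, (∀ a ∈ T, x ∈ Shr (r - δ) (Z (a / k)) ∧ x ∉ A a) → T.card ≤ n) ∧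
      (∀ a < p, C (a / k) (a % k) ⊆ A a) := by
  induction p with
  | zero =>
    intro δ hδ _
    refine ⟨fun _ => ∅, by simp, ?_, by simp⟩
    intro T hT x _
    have : T = ∅ := by simpa using hT
    simp [this]
  | succ p ih =>
    intro δ hδ hr
    obtain ⟨A, hA, hM, hCA⟩ := ih (3 * δ) (by positivity) (by rw [← hr]; ring)
    have h3p : (1 : ℝ) ≤ 3 ^ p := one_le_pow₀ (by norm_num)
    have hr3 : 3 * δ ≤ r := by rw [← hr, pow_succ]; nlinarith
    have hr0 : 0 < r := by linarith
    have hSnn : ∀ j, 0 ≤ S j := by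
      intro j
      induction j with
      | zero => exact hS0
      | succ j ihj => rw [hS]; have := hR j; linarith
    have hSmono : Monotone S := by
      apply monotone_nat_of_le_succ
      intro j
      rw [hS]; have := hR j; have := hSnn j; linarith
    have hSr : ∀ j, 3 * r ≤ S (j + 1) := by
      intro j
      rw [hS]; have := hR j; have := hSnn j; linarith
    let N : ℕ → Set X := fun a => {x | ∃ w ∈ A a, dist x w ≤ δ}
    have hAN : ∀ i, A i ⊆ N i := fun i x hx => ⟨x, hx, by simpa using hδ.le⟩
    let Ms : ℕ → Set X := fun a => {x | x ∈ Shr (r - δ) (Z (a / k)) ∧ x ∉ N a}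
    let Mb : ℕ → Set X := fun a => {x | x ∈ Shr (r - 3 * δ) (Z (a / k)) ∧ x ∉ A a}
    let pred : Finset ℕ → Prop := fun T => ∃ b ∈ T, b / k < p / k
    let P : Set X := {x | x ∈ Z (p / k) ∧
      ∃ T ⊆ Finset.range p, T.card = n ∧ pred T ∧ ∀ a ∈ T, x ∈ Ms a}
    have hsb : ∀ a, ∀ x x', x' ∈ Ms a → dist x x' ≤ δ → x ∈ Mb a := by
      intro a x x' hx' hd
      refine ⟨fun y hy => hx'.1 y ?_, fun hx => hx'.2 ⟨x, hx, by rw [dist_comm]; exact hd⟩⟩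
      have := dist_triangle x' x y
      rw [dist_comm x' x] at this
      linarith
    have hsb0 : ∀ a x, x ∈ Ms a → x ∈ Mb a := fun a x hx => hsb a x x hx (by simpa using hδ.le)
    have hPsc : Sc δ (S (p / k)) P := by
      intro x y hxy
      have := type_chain (Finset.range p) Ms Mb n pred hδ.le (fun a _ => hsb a) hM P
        (fun x hx => hx.2) x y hxy
      rcases this with rfl | ⟨T, hT, hTc, ⟨b, hbT, hbk⟩, hch⟩
      · rw [dist_self]; exact hSnn _
      · obtain ⟨i', hi', hi'T⟩ : ∃ i' ∈ Finset.range k, b / k * k + i' ∉ T := by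
          by_contra hcon
          push Not at hcon
          have h1 : (Finset.range k).image (fun i => b / k * k + i) ⊆ T := by
            intro z hz
            obtain ⟨i, hi, rfl⟩ := Finset.mem_image.mp hz
            exact hcon i hi
          have := Finset.card_le_card h1
          rw [Finset.card_image_of_injective _ (fun a b h => by simpa using h),
            Finset.card_range] at this
          omega
        rw [Finset.mem_range] at hi'
        have hdiv : (b / k * k + i') / k = b / k := by
          rw [mul_comm, Nat.mul_add_div (by omega), Nat.div_eq_of_lt hi', add_zero]
        have hlt : b / k * k + i' < p := by
          have h1 : (b / k + 1) * k ≤ p / k * k := Nat.mul_le_mul_right _ hbk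
          have h2 := Nat.div_mul_le_self p k
          rw [add_mul, one_mul] at h1
          omega
        have hsub : {z | ∀ a ∈ T, z ∈ Ms a} ⊆ A (b / k * k + i') := by
          intro z hz
          by_contra hzA
          have := hM (insert (b / k * k + i') T)
            (Finset.insert_subset (Finset.mem_range.mpr hlt) hT) z (by
            intro c hc
            rcases Finset.mem_insert.mp hc with rfl | hc
            · refine ⟨?_, hzA⟩
              rw [hdiv]
              exact (hsb0 b z (hz b hbT)).1
            · exact hsb0 c z (hz c hc))
          rw [Finset.card_insert_of_notMem hi'T] at this
          omega
        have h1 := hA _ hlt x y (hch.mono hsub (by linarith))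
        rw [hdiv] at h1
        have h2 : S (b / k + 1) ≤ S (p / k) := hSmono hbk
        linarith
    refine ⟨fun a => if a < p then N a else C (p / k) (p % k) ∪ P, ?_, ?_, ?_⟩
    · intro a ha
      by_cases hap : a < p
      · simp only [hap, if_true]
        have h1 := sc_nbhd hδ.le (by have := hSr (a / k); linarith) (hA a hap)
        exact h1.mono subset_rfl le_rfl (by linarith)
      · have : a = p := by omega
        subst this
        simp only [lt_irrefl, if_false]
        have h1 := sc_saturated (Z (a / k)) (C (a / k) (a % k)) P (r := r) (s := S (a / k) + 2 * r)
          hδ.le (by linarith) (hC _ _) (fun x hx => hx.1) (hSnn _) (by linarith) hPsc (hR _)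
          (hCC _ _ (Nat.mod_lt _ (by omega)))
        refine h1.mono subset_rfl le_rfl ?_
        rw [hS]; linarith
    · intro T hT x hx
      by_contra hcard
      push Not at hcard
      have hT0 : (T.erase p) ⊆ Finset.range p := by
        intro a ha
        have h1 := Finset.mem_range.mp (hT (Finset.mem_of_mem_erase ha))
        have h2 := Finset.ne_of_mem_erase ha
        simp; omega
      have hx0 : ∀ a ∈ T.erase p, x ∈ Ms a := by
        intro a ha
        have h1 := Finset.mem_range.mp (hT0 ha)
        have := hx a (Finset.mem_of_mem_erase ha)
        simp only [h1, if_true] at this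
        exact this
      have hc0 := hM _ hT0 x (fun a ha => hsb0 a x (hx0 a ha))
      have hpT : p ∈ T := by
        by_contra h
        rw [Finset.erase_eq_of_notMem h] at hc0
        omega
      have hcc := Finset.card_erase_of_mem hpT
      have hxp := hx p hpT
      simp only [lt_irrefl, if_false] at hxp
      have hxZ : x ∈ Z (p / k) := hxp.1 x (by rw [dist_self]; linarith)
      by_cases hpred : pred (T.erase p)
      · exact hxp.2 (Or.inr ⟨hxZ, T.erase p, hT0, by omega, hpred, hx0⟩)
      · have hall : ∀ a ∈ T, a / k = p / k := by
          intro a ha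
          have hap : a ≤ p := by have := Finset.mem_range.mp (hT ha); omega
          by_contra hne
          have hle : a / k ≤ p / k := Nat.div_le_div_right hap
          refine hpred ⟨a, Finset.mem_erase.mpr ⟨?_, ha⟩, by omega⟩
          rintro rfl; exact hne rfl
        have := hCn (p / k) (T.image (· % k)) (by
          intro z hz
          obtain ⟨a, _, rfl⟩ := Finset.mem_image.mp hz
          exact Finset.mem_range.mpr (Nat.mod_lt _ (by omega))) x hxZ (by
          intro i hi hxC
          obtain ⟨a, ha, rfl⟩ := Finset.mem_image.mp hi
          by_cases hap : a = p
          · subst hap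
            exact hxp.2 (Or.inl hxC)
          · have hae : a ∈ T.erase p := Finset.mem_erase.mpr ⟨hap, ha⟩
            refine (hx0 a hae).2 (hAN a (hCA a (Finset.mem_range.mp (hT0 hae)) ?_))
            rw [hall a ha]
            exact hxC)
        rw [Finset.card_image_of_injOn] at this
        · omega
        · intro a ha b hb hab
          have h1 := Nat.div_add_mod a k
          have h2 := Nat.div_add_mod b k
          rw [hall a ha] at h1
          rw [hall b hb] at h2
          simp only at hab
          omega
    · intro a ha
      by_cases hap : a < p
      · simp only [hap, if_true]
        exact (hCA a hap).trans (hAN a)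
      · have : a = p := by omega
        subst this
        simp only [lt_irrefl, if_false]
        exact Set.subset_union_left

lemma cover_all {X : Type*} [MetricSpace X] {m : ℕ} (hX : AsdimLE X m) (d : ℝ) (hd : 0 < d) :
    ∃ R : ℝ, 0 ≤ R ∧ ∃ W : ℕ → Set X, (∀ i, Sc d R (W i)) ∧ ∀ x, ∃ i < m + 1, x ∈ W i := by
  obtain ⟨R, hR, A, hA, hM⟩ := kolmogorov hX 0 d hd
  refine ⟨R, hR, fun i => if i < m + 1 then A i else ∅, ?_, ?_⟩
  · intro i
    by_cases hi : i < m + 1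
    · simp only [hi, if_true]; exact hA i hi
    · simp only [hi, if_false]
      intro x y h
      induction h with
      | refl => rw [dist_self]; exact hR
      | tail _ h2 _ => exact absurd h2.1 (by simp)
  · intro x
    by_contra hcon
    push Not at hcon
    have := hM (Finset.range (m + 1)) (by simp) x (by
      intro i hi hx
      have hi' := Finset.mem_range.mp hi
      apply hcon i hi'
      simpa only [hi', if_true] using hx)
    simp at this

lemma AsdimLE.mono {X : Type*} [MetricSpace X] {m n : ℕ} (hX : AsdimLE X m) (hmn : m ≤ n) :
    AsdimLE X n := by
  apply asdimLE_of_sc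
  intro d hd
  obtain ⟨R, _, W, hW, hc⟩ := cover_all hX d hd
  refine ⟨R, W, fun i _ => hW i, fun x => ?_⟩
  obtain ⟨i, hi, hx⟩ := hc x
  exact ⟨i, by omega, hx⟩

lemma asdimLE_of_asdim_le {X : Type*} [MetricSpace X] {n : ℕ} (h : asdim X ≤ (n : ℕ∞)) :
    AsdimLE X n := by
  have hne : {m : ℕ∞ | ∃ n : ℕ, m = (n : ℕ∞) ∧ AsdimLE X n}.Nonempty := by
    by_contra hcon
    rw [Set.not_nonempty_iff_eq_empty] at hcon
    unfold asdim at h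
    rw [hcon] at h
    simp at h
  obtain ⟨k, hk, hX⟩ := csInf_mem hne
  unfold asdim at h
  rw [hk] at h
  exact hX.mono (by exact_mod_cast h)

lemma orbit_coarse {Γ : Type*} [Group Γ] [MetricSpace Γ]
    (hinv : ∀ g x y : Γ, dist (g * x) (g * y) = dist x y)
    (hproper : ∀ (x : Γ) (r : ℝ), {y : Γ | dist x y ≤ r}.Finite)
    {X : Type*} [MetricSpace X] [MulAction Γ X]
    (hisom : ∀ (g : Γ) (x y : X), dist (g • x) (g • y) = dist x y) (x₀ : X) (t : ℝ) :
    ∃ c : ℝ, 0 < c ∧ ∀ a b : Γ, dist a b ≤ t → dist (a • x₀) (b • x₀) ≤ c := by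
  obtain ⟨c, hc⟩ := ((hproper 1 t).image (fun y => dist x₀ (y • x₀))).bddAbove
  refine ⟨max c 1, by positivity, fun a b hab => ?_⟩
  have h1 : dist (1 : Γ) (a⁻¹ * b) ≤ t := by
    rw [← hinv a]; simpa using hab
  have h2 := hc ⟨a⁻¹ * b, h1, rfl⟩
  have h3 : dist (a • x₀) (b • x₀) = dist x₀ ((a⁻¹ * b) • x₀) := by
    rw [← hisom a x₀, smul_smul]; simp
  rw [h3]
  exact h2.trans (le_max_left _ _)

lemma fiber_cover {Γ : Type*} [Group Γ] [MetricSpace Γ]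
    (hinv : ∀ g x y : Γ, dist (g * x) (g * y) = dist x y)
    {X : Type*} [MetricSpace X] [MulAction Γ X]
    (hisom : ∀ (g : Γ) (x y : X), dist (g • x) (g • y) = dist x y) (x₀ : X) (n q : ℕ)
    {Rf : ℝ} (hW : AsdimLE {g : Γ | dist (g • x₀) x₀ ≤ Rf} n)
    (Z : Set Γ) (r : ℝ) (hZ : ∀ g h, Ch Z r g h → dist (g • x₀) (h • x₀) ≤ Rf) (s : ℝ) :
    ∃ R : ℝ, 0 ≤ R ∧ ∃ C : ℕ → Set Γ, (∀ i, C i ⊆ Z) ∧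
      (∀ T ⊆ Finset.range (n + 1 + q), ∀ x ∈ Z, (∀ i ∈ T, x ∉ C i) → T.card ≤ n) ∧
      (∀ i < n + 1 + q, ∀ x y, CC Z r (C i) s x y → dist x y ≤ R) := by
  obtain ⟨R, hR, A, hA, hM⟩ := kolmogorov hW q (max s 1) (by positivity)
  obtain ⟨rp, hrp, hrpe⟩ := exists_rep Z r
  have hmem : ∀ g, (rp g)⁻¹ * g ∈ {g : Γ | dist (g • x₀) x₀ ≤ Rf} := by
    intro g
    have := hZ _ _ (hrp g)
    rw [Set.mem_setOf_eq, ← hisom (rp g), smul_smul]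
    simpa using this
  let φ : Γ → {g : Γ | dist (g • x₀) x₀ ≤ Rf} := fun g => ⟨(rp g)⁻¹ * g, hmem g⟩
  have hφ : ∀ a b, rp a = rp b → dist (φ a) (φ b) = dist a b := by
    intro a b h
    change dist ((rp a)⁻¹ * a) ((rp b)⁻¹ * b) = _
    rw [h, hinv]
  refine ⟨R, hR, fun i => {g | g ∈ Z ∧ φ g ∈ A i}, fun i g hg => hg.1, ?_, ?_⟩
  · intro T hT x hx h
    exact hM T hT (φ x) (fun i hi hh => h i hi ⟨hx, hh⟩)
  · intro i hi x y h
    have key : rp x = rp y ∧ Ch (A i) (max s 1) (φ x) (φ y) := by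
      induction h with
      | refl => exact ⟨rfl, Relation.ReflTransGen.refl⟩
      | tail _ h2 ih =>
        have he := hrpe _ _ h2.2.2.2
        refine ⟨ih.1.trans he, Relation.ReflTransGen.tail ih.2 ⟨h2.1.2, h2.2.1.2, ?_⟩⟩
        rw [hφ _ _ he]
        exact h2.2.2.1.trans (le_max_left _ _)
    rw [← hφ x y key.1]
    exact hA i hi _ _ key.2

lemma main_asdimLE {Γ : Type*} [Group Γ] [MetricSpace Γ]
    (hinv : ∀ g x y : Γ, dist (g * x) (g * y) = dist x y)
    (hproper : ∀ (x : Γ) (r : ℝ), {y : Γ | dist x y ≤ r}.Finite)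
    {X : Type*} [MetricSpace X] [MulAction Γ X]
    (hisom : ∀ (g : Γ) (x y : X), dist (g • x) (g • y) = dist x y) (x₀ : X) (n m : ℕ)
    (hW : ∀ R : ℝ, 0 < R → AsdimLE {g : Γ | dist (g • x₀) x₀ ≤ R} n)
    (hX : AsdimLE X m) : AsdimLE Γ (n + m) := by
  apply asdimLE_of_sc
  intro d hd
  obtain ⟨k, hkdef⟩ : ∃ k, k = n + 1 + m := ⟨_, rfl⟩
  have hk0 : 0 < k := by omega
  obtain ⟨r, hr⟩ : ∃ r : ℝ, 3 ^ ((m + 1) * k) * d = r := ⟨_, rfl⟩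
  have hr0 : 0 < r := by rw [← hr]; positivity
  obtain ⟨cd, hcd0, hcd⟩ := orbit_coarse hinv hproper hisom x₀ d
  obtain ⟨cr, hcr0, hcr⟩ := orbit_coarse hinv hproper hisom x₀ r
  obtain ⟨RB, hRB, B, hB, hBM⟩ := kolmogorov hX n cd hcd0
  have hL0 : 0 ≤ RB + cr := by positivity
  obtain ⟨RW, hRW, W, hWsc, hWcov⟩ := cover_all hX (cr + 2 * (RB + cr)) (by positivity)
  let Z : ℕ → Set Γ := fun j => {g | ∃ w ∈ W j, dist (g • x₀) w ≤ RB + cr}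
  have hZ : ∀ j g h, Ch (Z j) r g h → dist (g • x₀) (h • x₀) ≤ RW + 2 * (RB + cr) := by
    intro j g h hc
    exact lift_chain (fun g : Γ => g • x₀) (W j) hL0 hRW hcr (hWsc j) g h hc
  have hQ := fun j s => fiber_cover hinv hisom x₀ n m (hW (RW + 2 * (RB + cr)) (by positivity))
    (Z j) r (hZ j) s
  choose Rf hRf C hCZ hCn hCC using hQ
  let S : ℕ → ℝ := fun j => Nat.rec 0 (fun j s => 2 * s + Rf j (s + 2 * r) + 3 * r) j
  have hS : ∀ j, S (j + 1) = 2 * S j + Rf j (S j + 2 * r) + 3 * r := fun j => rfl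
  have hS0 : S 0 = 0 := rfl
  have hSnn : ∀ j, 0 ≤ S j := by
    intro j
    induction j with
    | zero => exact hS0.ge
    | succ j ihj => rw [hS]; have := hRf j (S j + 2 * r); linarith
  have hSmono : Monotone S := by
    apply monotone_nat_of_le_succ
    intro j
    rw [hS]; have := hRf j (S j + 2 * r); have := hSnn j; linarith
  obtain ⟨A, hA, hAM, -⟩ := stages (n := n) (k := k) (by omega) (r := r) Z
    (fun j => C j (S j + 2 * r)) S (fun j => Rf j (S j + 2 * r)) (fun j => hRf _ _) hS0.ge hS
    (fun j => hCZ j _) (fun j => by rw [hkdef]; exact hCn j _)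
    (fun j => by rw [hkdef]; exact hCC j _) ((m + 1) * k) d hd hr
  choose jj hjj hjW using hWcov
  choose rp hrp hrpe using fun i => exists_rep (B i) cd
  have hdiv : ∀ j i, i < k → (j * k + i) / k = j := by
    intro j i hi
    rw [mul_comm, Nat.mul_add_div hk0, Nat.div_eq_of_lt hi, add_zero]
  have hlt : ∀ y i, i < k → jj y * k + i < (m + 1) * k := by
    intro y i hi
    have h1 : (jj y + 1) * k ≤ (m + 1) * k := Nat.mul_le_mul_right _ (hjj y)
    rw [add_mul, one_mul] at h1
    omega
  refine ⟨S (m + 1), fun i => {g | g • x₀ ∈ B i ∧ g ∈ A (jj (rp i (g • x₀)) * k + i)}, ?_, ?_⟩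
  · intro i hi
    have hik : i < k := by omega
    intro x y hxy
    have key : rp i (x • x₀) = rp i (y • x₀) ∧ Ch (A (jj (rp i (x • x₀)) * k + i)) d x y := by
      induction hxy with
      | refl => exact ⟨rfl, Relation.ReflTransGen.refl⟩
      | @tail b c _ h2 ih =>
        have he : rp i (b • x₀) = rp i (c • x₀) := hrpe i _ _
          (Relation.ReflTransGen.single ⟨h2.1.1, h2.2.1.1, hcd _ _ h2.2.2⟩)
        refine ⟨ih.1.trans he, Relation.ReflTransGen.tail ih.2 ⟨?_, ?_, h2.2.2⟩⟩
        · rw [ih.1]; exact h2.1.2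
        · rw [ih.1, he]; exact h2.2.1.2
    have h1 := hA _ (hlt _ i hik) x y key.2
    rw [hdiv _ _ hik] at h1
    have h2 : S (jj (rp i (x • x₀)) + 1) ≤ S (m + 1) := hSmono (hjj _)
    linarith
  · intro g
    by_contra hcon
    push Not at hcon
    classical
    let I : Finset ℕ := (Finset.range k).filter (fun i => g • x₀ ∈ B i)
    have hIc : n + 1 ≤ I.card := by
      have h1 := hBM ((Finset.range k).filter (fun i => ¬ g • x₀ ∈ B i))
        (by
          intro i hi
          have := Finset.mem_range.mp (Finset.mem_filter.mp hi).1
          simp; omega) (g • x₀) (fun i hi => (Finset.mem_filter.mp hi).2)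
      have h2 := Finset.card_filter_add_card_filter_not (s := Finset.range k)
        (fun i => g • x₀ ∈ B i)
      rw [Finset.card_range] at h2
      change n + 1 ≤ ((Finset.range k).filter (fun i => g • x₀ ∈ B i)).card
      omega
    have hIk : ∀ i ∈ I, i < k := fun i hi => Finset.mem_range.mp (Finset.mem_filter.mp hi).1
    have := hAM (I.image (fun i => jj (rp i (g • x₀)) * k + i)) (by
      intro z hz
      obtain ⟨i, hi, rfl⟩ := Finset.mem_image.mp hz
      exact Finset.mem_range.mpr (hlt _ i (hIk i hi))) g (by
      intro a ha
      obtain ⟨i, hi, rfl⟩ := Finset.mem_image.mp ha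
      have hik := hIk i hi
      constructor
      · simp only [hdiv _ _ hik]
        intro y hy
        refine ⟨_, hjW (rp i (g • x₀)), ?_⟩
        have h1 := hB i (by omega) _ _ (hrp i (g • x₀))
        have h2 := hcr y g (by rw [dist_comm]; linarith)
        have h3 := dist_triangle (y • x₀) (g • x₀) (rp i (g • x₀))
        linarith
      · intro hgA
        exact hcon i (by omega) ⟨(Finset.mem_filter.mp hi).2, hgA⟩)
    rw [Finset.card_image_of_injOn] at this
    · omega
    · intro a ha b hb hab
      have h1 := congrArg (· % k) hab
      simpa [Nat.mod_eq_of_lt (hIk a ha), Nat.mod_eq_of_lt (hIk b hb)] using h1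

/-- Suppose a countable group `Γ` with a proper left invariant metric
acts by isometries on a geodesic metric space `X`. If for some `x₀ ∈ X` and `n ∈ ℕ` all
`R`-stabilizers `W_R(x₀) = {g : dist (g • x₀) x₀ ≤ R}` (with the metric restricted from
`Γ`) have asymptotic dimension at most `n`, then `asdim Γ ≤ n + asdim X`. -/
theorem asdim_le_of_action_on_geodesic_space {Γ : Type*} [Group Γ] [Countable Γ]
    [MetricSpace Γ]
    (hinv : ∀ g x y : Γ, dist (g * x) (g * y) = dist x y)
    (hproper : ∀ (x : Γ) (r : ℝ), {y : Γ | dist x y ≤ r}.Finite)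
    {X : Type*} [MetricSpace X]
    (hgeodesic : ∀ x y : X, ∃ f : ℝ → X, f 0 = x ∧ f (dist x y) = y ∧
      ∀ s ∈ Set.Icc (0 : ℝ) (dist x y), ∀ t ∈ Set.Icc (0 : ℝ) (dist x y),
        dist (f s) (f t) = |s - t|)
    [MulAction Γ X]
    (hisom : ∀ (g : Γ) (x y : X), dist (g • x) (g • y) = dist x y)
    (x₀ : X) (n : ℕ)
    (hW : ∀ R : ℝ, 0 < R → asdim {g : Γ | dist (g • x₀) x₀ ≤ R} ≤ (n : ℕ∞)) :
    asdim Γ ≤ (n : ℕ∞) + asdim X := by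
  by_cases hX : asdim X = ⊤
  · rw [hX]; simp
  · obtain ⟨m, hm⟩ := ENat.ne_top_iff_exists.mp hX
    have hXm : AsdimLE X m := asdimLE_of_asdim_le hm.symm.le
    have := main_asdimLE hinv hproper hisom x₀ n m (fun R hR => asdimLE_of_asdim_le (hW R hR)) hXm
    rw [← hm]
    exact sInf_le ⟨n + m, by push_cast; rfl, this⟩
end

section
/- Let φ : G → H be a homomorphism of countable groups with kernel K. Then asdim G ≤ asdim H + asdim K, where each of G, H, K is equipped with a proper left invariant metric. -/
/-- `A` splits into `d`-separated pieces of diameter at most `R`. -/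
def GoodSet {X : Type*} [MetricSpace X] (d R : ℝ) (A : Set X) : Prop :=
  ∃ e : Setoid X, (∀ x ∈ A, ∀ y ∈ A, dist x y ≤ d → e x y) ∧
    (∀ x ∈ A, ∀ y ∈ A, e x y → dist x y ≤ R)

theorem GoodSet.mono {X : Type*} [MetricSpace X] {d R R' : ℝ} {A : Set X}
    (h : GoodSet d R A) (hR : R ≤ R') : GoodSet d R' A := by
  obtain ⟨e, h1, h2⟩ := h
  exact ⟨e, h1, fun x hx y hy hxy => (h2 x hx y hy hxy).trans hR⟩

theorem goodSet_of_family {X : Type*} [MetricSpace X] {d R : ℝ} {U : Set (Set X)}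
    (hR : RBounded R U) (hd : DDisjoint d U) : GoodSet d R (⋃₀ U) := by
  refine ⟨⟨fun x y => ∀ V ∈ U, x ∈ V ↔ y ∈ V, fun x V _ => Iff.rfl,
    fun h V hV => (h V hV).symm, fun h h' V hV => (h V hV).trans (h' V hV)⟩, ?_, ?_⟩
  · have key : ∀ x ∈ ⋃₀ U, ∀ y ∈ ⋃₀ U, dist x y ≤ d → ∀ V ∈ U, x ∈ V → y ∈ V := by
      rintro x - y ⟨W, hW, hyW⟩ hxy V hV hxV
      by_contra hyV
      have hne : V ≠ W := by rintro rfl; exact hyV hyW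
      exact absurd (hd V hV W hW hne x hxV y hyW) (not_lt.mpr hxy)
    intro x hx y hy hxy V hV
    exact ⟨key x hx y hy hxy V hV, key y hy x hx (by rwa [dist_comm]) V hV⟩
  · rintro x ⟨V, hV, hxV⟩ y - hxy
    exact hR V hV x hxV y ((hxy V hV).1 hxV)

theorem GoodSet.family {X : Type*} [MetricSpace X] {d R : ℝ} {A : Set X}
    (h : GoodSet d R A) : ∃ U : Set (Set X), RBounded R U ∧ DDisjoint d U ∧ A ⊆ ⋃₀ U := by
  obtain ⟨e, h1, h2⟩ := h
  refine ⟨{V | ∃ x ∈ A, V = {y | y ∈ A ∧ e x y}}, ?_, ?_, ?_⟩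
  · rintro _ ⟨z, hz, rfl⟩ x ⟨hx, hzx⟩ y ⟨hy, hzy⟩
    exact h2 x hx y hy (e.trans (e.symm hzx) hzy)
  · rintro _ ⟨z, hz, rfl⟩ _ ⟨w, hw, rfl⟩ hne x ⟨hx, hzx⟩ y ⟨hy, hwy⟩
    by_contra hlt
    have hxy := h1 x hx y hy (not_lt.mp hlt)
    have hzw : e z w := e.trans (e.trans hzx hxy) (e.symm hwy)
    apply hne
    ext t
    exact ⟨fun ht => ⟨ht.1, e.trans (e.symm hzw) ht.2⟩, fun ht => ⟨ht.1, e.trans hzw ht.2⟩⟩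
  · intro x hx
    exact ⟨_, ⟨x, hx, rfl⟩, hx, e.refl x⟩

/-- Pulling back along an almost isometric map. -/
theorem GoodSet.pullback {X Y : Type*} [MetricSpace X] [MetricSpace Y] {d R s : ℝ} {A : Set Y}
    (h : GoodSet d R A) (C : Set X) (p : X → Y) (hp : ∀ x ∈ C, p x ∈ A)
    (h1 : ∀ x ∈ C, ∀ y ∈ C, dist (p x) (p y) ≤ dist x y + 2 * s)
    (h2 : ∀ x ∈ C, ∀ y ∈ C, dist x y ≤ dist (p x) (p y) + 2 * s) :
    GoodSet (d - 2 * s) (R + 2 * s) C := by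
  obtain ⟨e, he1, he2⟩ := h
  refine ⟨e.comap p, ?_, ?_⟩
  · intro x hx y hy hxy
    exact he1 _ (hp x hx) _ (hp y hy) (by linarith [h1 x hx y hy])
  · intro x hx y hy hxy
    have := he2 _ (hp x hx) _ (hp y hy) hxy
    linarith [h2 x hx y hy]

theorem GoodSet.thicken {X : Type*} [MetricSpace X] {d R s : ℝ} {A : Set X}
    (h : GoodSet d R A) : GoodSet (d - 2 * s) (R + 2 * s) {x | ∃ a ∈ A, dist x a ≤ s} := by
  have hex : ∀ x : X, ∃ a, (∃ a ∈ A, dist x a ≤ s) → a ∈ A ∧ dist x a ≤ s := by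
    intro x
    by_cases hx : ∃ a ∈ A, dist x a ≤ s
    · obtain ⟨a, ha⟩ := hx
      exact ⟨a, fun _ => ha⟩
    · exact ⟨x, fun h => absurd h hx⟩
  choose p hp using hex
  refine h.pullback _ p (fun x hx => (hp x hx).1) ?_ ?_
  · intro x hx y hy
    have := dist_triangle4 (p x) x y (p y)
    have h1 := (hp x hx).2
    have h2 := (hp y hy).2
    rw [dist_comm] at h1
    linarith
  · intro x hx y hy
    have := dist_triangle4 x (p x) (p y) y
    have h1 := (hp x hx).2
    have h2 := (hp y hy).2
    rw [dist_comm] at h2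
    linarith

theorem GoodSet.union {X : Type*} [MetricSpace X] {r R R' : ℝ} {A B : Set X}
    (hr : 0 ≤ r) (hR : 0 ≤ R) (hR' : 0 ≤ R')
    (hA : GoodSet r R A) (hB : GoodSet (2 * R + 3 * r) R' B) :
    GoodSet r (R + R' + 2 * (R + r)) (A ∪ B) := by
  obtain ⟨e, he1, he2⟩ := hA
  obtain ⟨f, hf1, hf2⟩ := hB
  let P : X → Prop := fun x => x ∈ B ∨ (x ∈ A ∧ ∃ a ∈ A, ∃ b ∈ B, e x a ∧ dist a b ≤ r)
  have hex : ∀ x : X, ∃ b, P x → b ∈ B ∧ dist x b ≤ R + r := by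
    intro x
    by_cases hx : P x
    · rcases hx with hx | ⟨hx, a, ha, b, hb, hxa, hab⟩
      · exact ⟨x, fun _ => ⟨hx, by rw [dist_self]; linarith⟩⟩
      · refine ⟨b, fun _ => ⟨hb, ?_⟩⟩
        linarith [dist_triangle x a b, he2 x hx a ha hxa]
    · exact ⟨x, fun h => absurd h hx⟩
  choose p hp using hex
  refine ⟨⟨fun x y => (P x ↔ P y) ∧ (P x → f (p x) (p y)) ∧ (¬ P x → e x y), ?_, ?_, ?_⟩, ?_, ?_⟩
  · exact fun x => ⟨Iff.rfl, fun _ => f.refl _, fun _ => e.refl _⟩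
  · rintro x y ⟨h1, h2, h3⟩
    exact ⟨h1.symm, fun h => f.symm (h2 (h1.2 h)), fun h => e.symm (h3 (fun h' => h (h1.1 h')))⟩
  · rintro x y z ⟨h1, h2, h3⟩ ⟨k1, k2, k3⟩
    exact ⟨h1.trans k1, fun h => f.trans (h2 h) (k2 (h1.1 h)),
      fun h => e.trans (h3 h) (k3 (fun h' => h (h1.2 h')))⟩
  · have key : ∀ x ∈ A ∪ B, ∀ y ∈ A ∪ B, dist x y ≤ r → P x → P y := by
      intro x hx y hy hxy hPx
      rcases hy with hy | hy
      · by_cases hxB : x ∈ B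
        · exact Or.inr ⟨hy, y, hy, x, hxB, e.refl y, by rwa [dist_comm]⟩
        · rcases hPx with h | ⟨hxA, a, ha, b, hb, hxa, hab⟩
          · exact absurd h hxB
          · exact Or.inr ⟨hy, a, ha, b, hb,
              e.trans (e.symm (he1 x hxA y hy hxy)) hxa, hab⟩
      · exact Or.inl hy
    intro x hx y hy hxy
    have hiff : P x ↔ P y :=
      ⟨key x hx y hy hxy, key y hy x hx (by rwa [dist_comm])⟩
    refine ⟨hiff, ?_, ?_⟩
    · intro hPx
      have h1 := hp x hPx
      have h2 := hp y (hiff.1 hPx)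
      refine hf1 _ h1.1 _ h2.1 ?_
      have h3 := dist_triangle4 (p x) x y (p y)
      have h4 := h1.2
      rw [dist_comm] at h4
      linarith [h2.2]
    · intro hPx
      have hxA : x ∈ A := hx.resolve_right (fun h => hPx (Or.inl h))
      have hyA : y ∈ A := hy.resolve_right (fun h => hPx (hiff.2 (Or.inl h)))
      exact he1 x hxA y hyA hxy
  · rintro x hx y hy ⟨hiff, h2, h3⟩
    by_cases hPx : P x
    · have h1 := hp x hPx
      have h2' := hp y (hiff.1 hPx)
      have h4 := hf2 _ h1.1 _ h2'.1 (h2 hPx)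
      have h3 := dist_triangle4 x (p x) (p y) y
      have h5 := h2'.2
      rw [dist_comm] at h5
      linarith [h1.2]
    · have hxA : x ∈ A := hx.resolve_right (fun h => hPx (Or.inl h))
      have hyA : y ∈ A := hy.resolve_right (fun h => hPx (hiff.2 (Or.inl h)))
      linarith [he2 x hxA y hyA (h3 hPx)]

theorem GoodSet.assemble {X : Type*} [MetricSpace X] {r R : ℝ} {W : Set X} (E : Setoid X)
    (hE : ∀ x ∈ W, ∀ y ∈ W, dist x y ≤ r → E x y)
    (h : ∀ v, GoodSet r R {x | x ∈ W ∧ E v x}) : GoodSet r R W := by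
  choose e he1 he2 using h
  refine ⟨⟨fun x y => E x y ∧ ∀ v, E v x → e v x y, ?_, ?_, ?_⟩, ?_, ?_⟩
  · exact fun x => ⟨E.refl x, fun v _ => (e v).refl x⟩
  · rintro x y ⟨h1, h2⟩
    exact ⟨E.symm h1, fun v hv => (e v).symm (h2 v (E.trans hv (E.symm h1)))⟩
  · rintro x y z ⟨h1, h2⟩ ⟨k1, k2⟩
    exact ⟨E.trans h1 k1, fun v hv => (e v).trans (h2 v hv) (k2 v (E.trans hv h1))⟩
  · intro x hx y hy hxy
    have hxy' := hE x hx y hy hxy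
    exact ⟨hxy', fun v hv => he1 v x ⟨hx, hv⟩ y ⟨hy, E.trans hv hxy'⟩ hxy⟩
  · rintro x hx y hy ⟨h1, h2⟩
    exact he2 x x ⟨hx, E.refl x⟩ y ⟨hy, h1⟩ (h2 x (E.refl x))

/-- The sequence of bounds used in the finite union argument. -/
noncomputable def boundSeq (r : ℝ) (F : ℝ → ℝ) : ℕ → ℝ
  | 0 => 0
  | c + 1 => boundSeq r F c + F (2 * boundSeq r F c + 3 * r) + 2 * (boundSeq r F c + r)

theorem boundSeq_nonneg {r : ℝ} {F : ℝ → ℝ} (hr : 0 < r) (hF : ∀ s, 0 < s → 0 < F s) (c : ℕ) :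
    0 ≤ boundSeq r F c := by
  induction c with
  | zero => simp [boundSeq]
  | succ c ih =>
    have := hF (2 * boundSeq r F c + 3 * r) (by linarith)
    simp only [boundSeq]
    linarith

theorem goodSet_iUnion {X : Type*} [MetricSpace X] {r : ℝ} {F : ℝ → ℝ} (hr : 0 < r)
    (hF : ∀ s, 0 < s → 0 < F s) (P : ℕ → Set X)
    (hP : ∀ c, GoodSet (2 * boundSeq r F c + 3 * r) (F (2 * boundSeq r F c + 3 * r)) (P c))
    (N : ℕ) : GoodSet r (boundSeq r F N) {x | ∃ c < N, x ∈ P c} := by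
  induction N with
  | zero => exact ⟨⊤, by simp, by simp⟩
  | succ N ih =>
    have h0 := boundSeq_nonneg hr hF N
    have := GoodSet.union hr.le h0
      (hF (2 * boundSeq r F N + 3 * r) (by linarith)).le ih (hP N)
    have heq : {x | ∃ c < N + 1, x ∈ P c} = {x | ∃ c < N, x ∈ P c} ∪ P N := by
      ext x
      constructor
      · rintro ⟨c, hc, hx⟩
        rcases Nat.lt_succ_iff_lt_or_eq.mp hc with h | rfl
        · exact Or.inl ⟨c, h, hx⟩
        · exact Or.inr hx
      · rintro (⟨c, hc, hx⟩ | hx)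
        · exact ⟨c, by omega, hx⟩
        · exact ⟨N, by omega, hx⟩
    rw [heq]
    exact this

open Classical in
/-- Covers by `m` families with multiplicity at least `m - n`. -/
def KolmCover (X : Type*) [MetricSpace X] (n m : ℕ) : Prop :=
  ∀ d : ℝ, 0 < d → ∃ R : ℝ, 0 < R ∧ ∃ A : Fin m → Set X, (∀ i, GoodSet d R (A i)) ∧
    ∀ x, m ≤ (Finset.univ.filter (fun i => x ∈ A i)).card + n

theorem AsdimLE.kolm {X : Type*} [MetricSpace X] {n : ℕ} (h : AsdimLE X n) :
    KolmCover X n (n + 1) := by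
  classical
  intro d hd
  obtain ⟨R, hR, U, h1, h2, h3⟩ := h d hd
  refine ⟨R, hR, fun i => ⋃₀ U i, fun i => goodSet_of_family (h1 i) (h2 i), fun x => ?_⟩
  have hx : x ∈ ⋃ i, ⋃₀ U i := by rw [h3]; trivial
  obtain ⟨i, hi⟩ := Set.mem_iUnion.mp hx
  have : 0 < (Finset.univ.filter (fun i => x ∈ ⋃₀ U i)).card :=
    Finset.card_pos.mpr ⟨i, by simpa using hi⟩
  have h4 : n + 1 ≤ (Finset.univ.filter (fun i => x ∈ ⋃₀ U i)).card + n := by omega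
  convert h4

theorem KolmCover.step {X : Type*} [MetricSpace X] {n m : ℕ} (hnm : n < m)
    (h : KolmCover X n m) : KolmCover X n (m + 1) := by
  classical
  intro d hd
  obtain ⟨R, hR, A, hA, hcard⟩ := h (3 * d) (by linarith)
  let A' : Fin m → Set X := fun i => {x | ∃ a ∈ A i, dist x a ≤ d}
  let B : Set X := {x | (Finset.univ.filter (fun i => x ∈ A' i)).card + n ≤ m}
  have hsub : ∀ i x, x ∈ A i → x ∈ A' i := fun i x hx => ⟨x, hx, by simp [hd.le]⟩
  have hB : ∀ x ∈ B, ∀ i, x ∈ A' i → x ∈ A i := by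
    intro x hx i hi
    have hx' : (Finset.univ.filter (fun i => x ∈ A' i)).card + n ≤ m := hx
    have hc : m ≤ (Finset.univ.filter (fun i => x ∈ A i)).card + n := by convert hcard x
    have heq : Finset.univ.filter (fun i => x ∈ A i) = Finset.univ.filter (fun i => x ∈ A' i) := by
      apply Finset.eq_of_subset_of_card_le
      · intro j hj
        simp only [Finset.mem_filter, Finset.mem_univ, true_and] at hj ⊢
        exact hsub j x hj
      · omega
    have : i ∈ Finset.univ.filter (fun i => x ∈ A' i) := by simpa using hi
    rw [← heq] at this
    simpa using this
  refine ⟨R + 2 * d, by linarith, Fin.cons B A', ?_, ?_⟩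
  · intro i
    refine Fin.cases ?_ (fun i => ?_) i
    · simp only [Fin.cons_zero]
      choose e he1 he2 using hA
      refine ⟨⟨fun x y => ∀ i, (x ∈ A i ↔ y ∈ A i) ∧ (x ∈ A i → e i x y), ?_, ?_, ?_⟩, ?_, ?_⟩
      · exact fun x i => ⟨Iff.rfl, fun _ => (e i).refl x⟩
      · exact fun {x y} h i => ⟨(h i).1.symm, fun hy => (e i).symm ((h i).2 ((h i).1.2 hy))⟩
      · exact fun {x y z} h k i => ⟨(h i).1.trans (k i).1,
          fun hx => (e i).trans ((h i).2 hx) ((k i).2 ((h i).1.1 hx))⟩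
      · intro x hx y hy hxy i
        have hiff : x ∈ A i ↔ y ∈ A i :=
          ⟨fun h => hB y hy i ⟨x, h, by rwa [dist_comm]⟩, fun h => hB x hx i ⟨y, h, hxy⟩⟩
        exact ⟨hiff, fun h => he1 i x h y (hiff.1 h) (by linarith)⟩
      · intro x hx y hy hxy
        have hc : m ≤ (Finset.univ.filter (fun i => x ∈ A i)).card + n := by convert hcard x
        have hpos : 0 < (Finset.univ.filter (fun i => x ∈ A i)).card := by omega
        obtain ⟨i, hi⟩ := Finset.card_pos.mp hpos
        have hi' : x ∈ A i := by simpa using hi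
        have := he2 i x hi' y ((hxy i).1.1 hi') ((hxy i).2 hi')
        linarith
    · simp only [Fin.cons_succ]
      have := (hA i).thicken (s := d)
      rwa [show 3 * d - 2 * d = d by ring] at this
  · intro x
    have hc : m ≤ (Finset.univ.filter (fun i => x ∈ A i)).card + n := by convert hcard x
    have hle : (Finset.univ.filter (fun i => x ∈ A i)).card
        ≤ (Finset.univ.filter (fun i => x ∈ A' i)).card := by
      apply Finset.card_le_card
      intro j hj
      simp only [Finset.mem_filter, Finset.mem_univ, true_and] at hj ⊢
      exact hsub j x hj
    have hgoal : m + 1 ≤ (Finset.univ.filter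
        (fun i => x ∈ (Fin.cons B A' : Fin (m + 1) → Set X) i)).card + n := by
      rw [Fin.card_filter_univ_succ]
      simp only [Fin.cons_zero, Fin.cons_succ, Function.comp_def]
      by_cases hx : x ∈ B
      · rw [if_pos hx]; omega
      · rw [if_neg hx]
        have : ¬ ((Finset.univ.filter (fun i => x ∈ A' i)).card + n ≤ m) := hx
        omega
    convert hgoal

theorem AsdimLE.kolm_add {X : Type*} [MetricSpace X] {n : ℕ} (h : AsdimLE X n) (k : ℕ) :
    KolmCover X n (n + k + 1) := by
  induction k with
  | zero => exact h.kolm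
  | succ k ih => exact ih.step (by omega)

/-- Greedy colouring of a countable graph of bounded degree. -/
theorem exists_greedy {V : Type*} [Countable V] (adj : V → V → Prop) (N : ℕ)
    (hsymm : ∀ x y, adj x y → adj y x)
    (hfin : ∀ x, {y | adj x y}.Finite) (hN : ∀ x, {y | adj x y}.ncard ≤ N) :
    ∃ c : V → ℕ, (∀ x, c x < N + 1) ∧ ∀ x y, adj x y → x ≠ y → c x ≠ c y := by
  classical
  obtain ⟨ι, hι⟩ := exists_injective_nat V
  let lt : V → V → Prop := fun x y => ι x < ι y
  have wf : WellFounded lt := (measure ι).wf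
  let step : (x : V) → ((y : V) → lt y x → ℕ) → ℕ := fun x f =>
    sInf {n | ∀ y (hy : lt y x), adj x y → f y hy ≠ n}
  let c : V → ℕ := wf.fix step
  have hc : ∀ x, c x = sInf {n | ∀ y, lt y x → adj x y → c y ≠ n} := fun x => wf.fix_eq step x
  have hmem : ∀ x, ∃ n < N + 1, ∀ y, lt y x → adj x y → c y ≠ n := by
    intro x
    by_contra hcon
    push Not at hcon
    have hsub : (Finset.range (N + 1) : Set ℕ) ⊆ c '' {y | adj x y} := by
      intro n hn
      obtain ⟨y, _, hy, hyn⟩ := hcon n (by simpa using hn)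
      exact ⟨y, hy, hyn⟩
    have h1 := Set.ncard_le_ncard hsub ((hfin x).image c)
    have h2 := Set.ncard_image_le (f := c) (hfin x)
    rw [Set.ncard_coe_finset, Finset.card_range] at h1
    have := hN x
    omega
  refine ⟨c, ?_, ?_⟩
  · intro x
    obtain ⟨n, hn, h⟩ := hmem x
    rw [hc]
    exact lt_of_le_of_lt (Nat.sInf_le h) hn
  · have key : ∀ x y, lt y x → adj x y → c y ≠ c x := by
      intro x y hlt hadj
      obtain ⟨n, hn, h⟩ := hmem x
      have hs : c x ∈ {n | ∀ y, lt y x → adj x y → c y ≠ n} := by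
        rw [hc x]
        exact Nat.sInf_mem ⟨n, h⟩
      exact hs y hlt hadj
    intro x y hadj hne
    rcases lt_trichotomy (ι x) (ι y) with h | h | h
    · exact key y x h (hsymm _ _ hadj)
    · exact absurd (hι h) hne
    · exact (key x y h hadj).symm

theorem asdimLE_add {G H : Type*} [Group G] [Group H]
    [Countable H] [MetricSpace G] [MetricSpace H]
    (hinvG : ∀ g x y : G, dist (g * x) (g * y) = dist x y)
    (hproperG : ∀ (x : G) (r : ℝ), {y : G | dist x y ≤ r}.Finite)
    (hinvH : ∀ g x y : H, dist (g * x) (g * y) = dist x y)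
    (hproperH : ∀ (x : H) (r : ℝ), {y : H | dist x y ≤ r}.Finite)
    (φ : G →* H) (n k : ℕ) (hH : AsdimLE H n) (hK : AsdimLE φ.ker k) : AsdimLE G (n + k) := by
  classical
  intro r hr
  -- control of the homomorphism
  obtain ⟨D, hD0, hD⟩ : ∃ D : ℝ, 0 < D ∧ ∀ x y : G, dist x y ≤ r → dist (φ x) (φ y) ≤ D := by
    obtain ⟨D, hD⟩ := ((hproperG 1 r).image (fun y => dist (1 : H) (φ y))).bddAbove
    refine ⟨max D 1, by positivity, fun x y hxy => le_max_of_le_left ?_⟩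
    have h1 : dist (1 : G) (x⁻¹ * y) ≤ r := by
      rw [← hinvG x]; simpa using hxy
    have h2 : dist (1 : H) (φ (x⁻¹ * y)) ≤ D := hD ⟨_, h1, rfl⟩
    rw [← hinvH (φ x)] at h2
    simpa using h2
  obtain ⟨RH, hRH, A, hA, hcard⟩ := hH.kolm_add k D hD0
  choose e he1 he2 using hA
  -- colouring
  obtain ⟨N, c, hcN, hc⟩ : ∃ N : ℕ, ∃ c : H → ℕ, (∀ x, c x < N) ∧
      ∀ x y, dist x y ≤ RH → x ≠ y → c x ≠ c y := by
    obtain ⟨c, h1, h2⟩ := exists_greedy (fun x y : H => dist x y ≤ RH)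
      ({y : H | dist 1 y ≤ RH}.ncard) (fun x y h => by rwa [dist_comm])
      (fun x => hproperH x RH) (by
        intro x
        refine Set.ncard_le_ncard_of_injOn (fun y => x⁻¹ * y) ?_ ?_ (hproperH 1 RH)
        · intro y hy
          have hy' : dist x y ≤ RH := hy
          rw [← hinvH x⁻¹] at hy'
          simpa using hy'
        · intro y _ z _ hyz
          exact mul_left_cancel hyz)
    exact ⟨_, c, h1, h2⟩
  -- the choice of indices
  have hτ : ∀ h : H, ∃ τ : Fin (k + 1) → Fin (n + k + 1), Function.Injective τ ∧
      ∀ j, h ∈ A (τ j) := by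
    intro h
    have h1 : n + k + 1 ≤ (Finset.univ.filter (fun i => h ∈ A i)).card + n := by
      convert hcard h
    have h2 : Fintype.card (Fin (k + 1)) ≤ Fintype.card {i // h ∈ A i} := by
      rw [Fintype.card_subtype, Fintype.card_fin]
      omega
    obtain ⟨f⟩ := Function.Embedding.nonempty_of_card_le h2
    exact ⟨fun j => (f j).1, Subtype.val_injective.comp f.injective, fun j => (f j).2⟩
  choose τ hτinj hτmem using hτ
  -- families in the kernel
  have hK' : ∀ s : ℝ, ∃ R : ℝ, 0 < s → 0 < R ∧ ∃ C : Fin (k + 1) → Set φ.ker,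
      (∀ j, GoodSet s R (C j)) ∧ ∀ x, ∃ j, x ∈ C j := by
    intro s
    by_cases hs : 0 < s
    · obtain ⟨R, hR, U, h1, h2, h3⟩ := hK s hs
      refine ⟨R, fun _ => ⟨hR, fun j => ⋃₀ U j, fun j => goodSet_of_family (h1 j) (h2 j), ?_⟩⟩
      intro x
      have hx : x ∈ ⋃ i, ⋃₀ U i := by rw [h3]; trivial
      exact Set.mem_iUnion.mp hx
    · exact ⟨0, fun h => absurd h hs⟩
  choose F hF using hK'
  have hFpos : ∀ s, 0 < s → 0 < F s := fun s hs => (hF s hs).1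
  let s : ℕ → ℝ := fun c => 2 * boundSeq r F c + 3 * r
  have hs : ∀ c, 0 < s c := fun c => by
    have := boundSeq_nonneg hr hFpos c
    simp only [s]; linarith
  choose C hCgood hCcov using fun c => (hF (s c) (hs c)).2
  -- sections
  have hsec : ∀ h : H, ∃ g : G, (∃ x, φ x = h) → φ g = h := by
    intro h
    by_cases hx : ∃ x, φ x = h
    · obtain ⟨x, hx⟩ := hx
      exact ⟨x, fun _ => hx⟩
    · exact ⟨1, fun h => absurd h hx⟩
  choose σ hσ using hsec
  have hker : ∀ x : G, (σ (φ x))⁻¹ * x ∈ φ.ker := by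
    intro x
    rw [MonoidHom.mem_ker, map_mul, map_inv, hσ (φ x) ⟨x, rfl⟩, inv_mul_cancel]
  let q : G → φ.ker := fun x => ⟨(σ (φ x))⁻¹ * x, hker x⟩
  have hq : ∀ x y, φ x = φ y → dist (q x) (q y) = dist x y := by
    intro x y hxy
    change dist ((σ (φ x))⁻¹ * x) ((σ (φ y))⁻¹ * y) = dist x y
    rw [hxy, hinvG]
  let W : Fin (n + k + 1) → Set G := fun i =>
    {x | ∃ j, τ (φ x) j = i ∧ q x ∈ C (c (φ x)) j}
  have hWA : ∀ i x, x ∈ W i → φ x ∈ A i := by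
    rintro i x ⟨j, rfl, -⟩
    exact hτmem _ _
  have hW : ∀ i, GoodSet r (boundSeq r F N) (W i) := by
    intro i
    refine GoodSet.assemble ((e i).comap φ) ?_ ?_
    · intro x hx y hy hxy
      exact he1 i _ (hWA i x hx) _ (hWA i y hy) (hD x y hxy)
    · intro v
      let P : ℕ → Set G := fun a => {x | (x ∈ W i ∧ (e i).comap φ v x) ∧ c (φ x) = a}
      have heq : {x | x ∈ W i ∧ (e i).comap φ v x} = {x | ∃ a < N, x ∈ P a} := by
        ext x
        exact ⟨fun hx => ⟨c (φ x), hcN _, hx, rfl⟩, fun ⟨a, _, hx⟩ => hx.1⟩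
      rw [heq]
      refine goodSet_iUnion hr hFpos P ?_ N
      intro a
      have hPeq : ∀ x ∈ P a, ∀ y ∈ P a, φ x = φ y := by
        rintro x ⟨⟨hx, hvx⟩, hxa⟩ y ⟨⟨hy, hvy⟩, hya⟩
        by_contra hne
        have hxy : e i (φ x) (φ y) := (e i).trans ((e i).symm hvx) hvy
        exact hc _ _ (he2 i _ (hWA i x hx) _ (hWA i y hy) hxy) hne (hxa.trans hya.symm)
      by_cases hemp : ∃ x₀, x₀ ∈ P a
      · obtain ⟨x₀, hx₀⟩ := hemp
        obtain ⟨j, hj, hqj⟩ := hx₀.1.1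
        have := (hCgood a j).pullback (s := 0) (P a) q (by
          intro x hx
          obtain ⟨j', hj', hqj'⟩ := hx.1.1
          have : j' = j := by
            apply hτinj (φ x)
            rw [hj', hPeq x hx x₀ hx₀, hj]
          rw [hx.2, this] at hqj'
          exact hqj')
          (by intro x hx y hy; rw [hq x y (hPeq x hx y hy)]; linarith)
          (by intro x hx y hy; rw [hq x y (hPeq x hx y hy)]; linarith)
        simpa [s] using this
      · exact ⟨⊤, fun x hx => absurd ⟨x, hx⟩ hemp, fun x hx => absurd ⟨x, hx⟩ hemp⟩
  have hfam := fun i => ((hW i).mono (le_max_left (boundSeq r F N) 1)).family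
  choose U hU1 hU2 hU3 using hfam
  refine ⟨max (boundSeq r F N) 1, by positivity, U, hU1, hU2, ?_⟩
  refine Set.eq_univ_of_forall fun x => ?_
  obtain ⟨j, hj⟩ := hCcov (c (φ x)) (q x)
  exact Set.mem_iUnion.mpr ⟨τ (φ x) j, hU3 _ ⟨j, rfl, hj⟩⟩

theorem asdim_spec {X : Type*} [MetricSpace X] (h : asdim X ≠ ⊤) :
    ∃ n : ℕ, asdim X = n ∧ AsdimLE X n := by
  have hne : {m : ℕ∞ | ∃ n : ℕ, m = (n : ℕ∞) ∧ AsdimLE X n}.Nonempty := by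
    by_contra hcon
    rw [Set.not_nonempty_iff_eq_empty] at hcon
    exact h (by rw [asdim, hcon, sInf_empty])
  exact csInf_mem hne

/-- **Hurewicz type formula.** Let `φ : G → H` be a homomorphism of countable
groups with kernel `K`, each group equipped with a proper left invariant metric (`K` with
the metric restricted from `G`). Then `asdim G ≤ asdim H + asdim K`. -/
theorem asdim_le_asdim_add_asdim_ker {G H : Type*} [Group G] [Group H]
    [Countable G] [Countable H] [MetricSpace G] [MetricSpace H]
    (hinvG : ∀ g x y : G, dist (g * x) (g * y) = dist x y)
    (hproperG : ∀ (x : G) (r : ℝ), {y : G | dist x y ≤ r}.Finite)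
    (hinvH : ∀ g x y : H, dist (g * x) (g * y) = dist x y)
    (hproperH : ∀ (x : H) (r : ℝ), {y : H | dist x y ≤ r}.Finite)
    (φ : G →* H) :
    asdim G ≤ asdim H + asdim φ.ker := by
  by_cases h1 : asdim H = ⊤
  · simp [h1]
  by_cases h2 : asdim φ.ker = ⊤
  · simp [h2]
  obtain ⟨n, hn, hn'⟩ := asdim_spec h1
  obtain ⟨k, hk, hk'⟩ := asdim_spec h2
  rw [hn, hk]
  exact sInf_le ⟨n + k, by push_cast; rfl,
    asdimLE_add hinvG hproperG hinvH hproperH φ n k hn' hk'⟩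
end

section
/- Let A be a countable abelian group equipped with a proper left invariant metric. Then asdim A = dim_ℚ(A ⊗_ℤ ℚ), where both sides may be infinite: asdim A equals n ∈ ℕ if and only if the ℚ-vector space A ⊗_ℤ ℚ has dimension n, and asdim A = ∞ if and only if A ⊗_ℤ ℚ is infinite dimensional. -/
open scoped TensorProduct

/-! ### A discrete Poincaré–Miranda theorem, via mod 2 cubical cochains -/

namespace AsdimHex

/-- unit vector -/
def ee (i : ℕ) : ℕ → ℤ := Pi.single i 1

/-- difference operator -/
def dl (i : ℕ) (g : (ℕ → ℤ) → ZMod 2) : (ℕ → ℤ) → ZMod 2 := fun x => g (x + ee i) - g x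

/-- iterated cubical cup product of the coboundaries of `f 0, …, f (k-1)` -/
def eta (f : ℕ → (ℕ → ℤ) → ZMod 2) : ℕ → Finset ℕ → (ℕ → ℤ) → ZMod 2
  | 0, _, _ => 1
  | k + 1, I, x => ∑ i ∈ I, dl i (fun y => f k y * eta f k (I.erase i) y) x

theorem dl_sum {s : Finset ℕ} (i : ℕ) (g : ℕ → (ℕ → ℤ) → ZMod 2) (x : ℕ → ℤ) :
    dl i (fun y => ∑ j ∈ s, g j y) x = ∑ j ∈ s, dl i (g j) x := by
  simp [dl, Finset.sum_sub_distrib]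

theorem dl_comm (i j : ℕ) (g : (ℕ → ℤ) → ZMod 2) (x : ℕ → ℤ) :
    dl i (dl j g) x = dl j (dl i g) x := by
  simp only [dl]
  rw [add_right_comm x]
  ring

theorem eta_closed (f : ℕ → (ℕ → ℤ) → ZMod 2) (k : ℕ) (I : Finset ℕ) (x : ℕ → ℤ) :
    ∑ i ∈ I, dl i (eta f k (I.erase i)) x = 0 := by
  cases k with
  | zero => simp [dl, eta]
  | succ k =>
    have h : ∀ i ∈ I, dl i (eta f (k+1) (I.erase i)) x =
        ∑ j ∈ I.erase i, dl i (dl j (fun y => f k y * eta f k ((I.erase i).erase j) y)) x := by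
      intro i _
      rw [← dl_sum]
      rfl
    rw [Finset.sum_congr rfl h, Finset.sum_sigma']
    refine Finset.sum_involution (fun p _ => ⟨p.2, p.1⟩) ?_ ?_ ?_ ?_
    · rintro ⟨i, j⟩ hp
      simp only
      rw [dl_comm j i, Finset.erase_right_comm (a := j) (b := i)]
      exact CharTwo.add_self_eq_zero _
    · rintro ⟨i, j⟩ hp _ h
      simp at hp h
      exact hp.2.1 h.1
    · rintro ⟨i, j⟩ hp
      simp at hp ⊢
      tauto
    · rintro ⟨i, j⟩ hp
      rfl

theorem eta_succ (f : ℕ → (ℕ → ℤ) → ZMod 2) (k : ℕ) (I : Finset ℕ) (x : ℕ → ℤ) :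
    eta f (k+1) I x = ∑ i ∈ I, dl i (f k) x * eta f k (I.erase i) (x + ee i) := by
  have h := eta_closed f k I x
  have : eta f (k+1) I x = ∑ i ∈ I, dl i (f k) x * eta f k (I.erase i) (x + ee i)
      + f k x * ∑ i ∈ I, dl i (eta f k (I.erase i)) x := by
    rw [Finset.mul_sum, ← Finset.sum_add_distrib]
    simp only [eta]
    refine Finset.sum_congr rfl fun i _ => ?_
    simp only [dl]
    ring
  rw [this, h]; simp

theorem eta_vanish (f : ℕ → (ℕ → ℤ) → ZMod 2) (j : ℕ) (P : Finset ℕ → (ℕ → ℤ) → Prop)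
    (h1 : ∀ J y, P J y → ∀ l ∈ J, P (J.erase l) (y + ee l))
    (h2 : ∀ J y, P J y → ∀ l ∈ J, dl l (f j) y = 0) :
    ∀ k, j < k → ∀ J y, P J y → eta f k J y = 0 := by
  intro k
  induction k with
  | zero => intro h; omega
  | succ k ih =>
    intro hk J y hP
    rw [eta_succ]
    refine Finset.sum_eq_zero fun l hl => ?_
    rcases Nat.lt_succ_iff_lt_or_eq.1 hk with h | rfl
    · rw [ih h _ _ (h1 J y hP l hl), mul_zero]
    · rw [h2 J y hP l hl, zero_mul]

/-- sum over a box -/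
def bx (N : ℕ) : ℕ → ((ℕ → ℤ) → ZMod 2) → (ℕ → ℤ) → ZMod 2
  | 0, g, x => g x
  | k + 1, g, x => ∑ s ∈ Finset.range N, bx N k g (x + s • ee k)

theorem ee_ne {i j : ℕ} (h : i ≠ j) : ee i j = 0 := by simp [ee, h.symm]
theorem ee_self (i : ℕ) : ee i i = 1 := by simp [ee]

theorem bx_congr (N k i : ℕ) (hi : k ≤ i) (g g' : (ℕ → ℤ) → ZMod 2) :
    ∀ x, (∀ y, y i = x i → g y = g' y) → bx N k g x = bx N k g' x := by
  induction k with
  | zero => intro x h; exact h x rfl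
  | succ k ih =>
    intro x h
    refine Finset.sum_congr rfl fun s _ => ?_
    refine ih (by omega) _ fun y hy => h y ?_
    rw [hy]
    simp [ee_ne (show k ≠ i by omega)]

theorem bx_zero (N k : ℕ) (x) : bx N k (fun _ => 0) x = 0 := by
  induction k generalizing x with
  | zero => rfl
  | succ k ih => simp [bx, ih]

theorem bx_sum (N k : ℕ) (s : Finset ℕ) (g : ℕ → (ℕ → ℤ) → ZMod 2) (x) :
    bx N k (fun y => ∑ i ∈ s, g i y) x = ∑ i ∈ s, bx N k (g i) x := by
  induction k generalizing x with
  | zero => rfl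
  | succ k ih =>
    simp only [bx, ih]
    rw [Finset.sum_comm]

theorem bx_shift (N k : ℕ) (g : (ℕ → ℤ) → ZMod 2) (x v : ℕ → ℤ) :
    bx N k g (x + v) = bx N k (fun y => g (y + v)) x := by
  induction k generalizing x with
  | zero => rfl
  | succ k ih =>
    simp only [bx]
    refine Finset.sum_congr rfl fun s _ => ?_
    rw [← ih, add_right_comm]

theorem bx_top (N k : ℕ) (h : (ℕ → ℤ) → ZMod 2) (x) :
    bx N (k+1) (dl k h) x = bx N k (fun y => h (y + N • ee k) - h y) x := by
  simp only [bx]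
  simp only [bx_shift]
  rw [← bx_sum]
  congr 1
  funext y
  have := Finset.sum_range_sub (fun s : ℕ => h (y + s • ee k)) N
  simp only [zero_smul, add_zero] at this
  rw [← this]
  refine Finset.sum_congr rfl fun s _ => ?_
  simp only [dl, add_smul, one_smul, add_assoc]

theorem bx_side (N k i : ℕ) (hi : i < k) (h : (ℕ → ℤ) → ZMod 2)
    (h0 : ∀ y : ℕ → ℤ, y i = 0 → h y = 0) (hN : ∀ y : ℕ → ℤ, y i = (N : ℤ) → h y = 0) :
    ∀ x : ℕ → ℤ, x i = 0 → bx N k (dl i h) x = 0 := by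
  induction k with
  | zero => omega
  | succ k ih =>
    intro x hx
    rcases Nat.lt_succ_iff_lt_or_eq.1 hi with hk | rfl
    · refine Finset.sum_eq_zero fun s _ => ih hk _ ?_
      simp [hx, ee_ne (show k ≠ i by omega)]
    · rw [bx_top, bx_congr N i i le_rfl _ (fun _ => 0), bx_zero]
      intro y hy
      rw [hx] at hy
      rw [h0 y hy, hN]
      · simp
      · simp [hy, ee_self]

theorem bx_eta (N : ℕ) (f : ℕ → (ℕ → ℤ) → ZMod 2) (m : ℕ)
    (h0 : ∀ j < m, ∀ y, y j ≤ 0 → f j y = 0) (hN : ∀ j < m, ∀ y, (N : ℤ) ≤ y j → f j y = 1) :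
    ∀ k ≤ m, ∀ x, (∀ i < k, x i = 0) → bx N k (eta f k (Finset.range k)) x = 1 := by
  intro k
  induction k with
  | zero => intro _ x _; rfl
  | succ k ih =>
    intro hk x hx
    have e : eta f (k+1) (Finset.range (k+1)) = fun x => ∑ i ∈ Finset.range (k+1),
      dl i (fun y => f k y * eta f k ((Finset.range (k+1)).erase i) y) x := by
      funext x; rfl
    rw [e, bx_sum, Finset.sum_range_succ, Finset.sum_eq_zero, zero_add]
    · rw [bx_top, Finset.range_add_one, Finset.erase_insert (by simp)]
      rw [bx_congr N k k le_rfl _ (fun y => eta f k (Finset.range k) (y + N • ee k)),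
        ← bx_shift]
      · refine ih (by omega) _ fun i hi => ?_
        simp [hx i (by omega), ee_ne (show k ≠ i by omega)]
      · intro y hy
        rw [hx k (by omega)] at hy
        rw [h0 k (by omega) y hy.le, hN k (by omega)]
        · simp
        · simp [hy, ee_self]
    · intro i hi
      have hi : i < k := Finset.mem_range.1 hi
      have key : ∀ c : ℤ, (∀ y y' : ℕ → ℤ, y i = c → y' i = c → f i y = f i y') →
          ∀ y, y i = c → eta f k ((Finset.range (k+1)).erase i) y = 0 := by
        intro c hc y hy
        refine eta_vanish f i (fun J y => i ∉ J ∧ y i = c) ?_ ?_ k hi _ y ⟨by simp, hy⟩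
        · rintro J y ⟨hJ, hy⟩ l hl
          refine ⟨fun h => hJ (Finset.mem_of_mem_erase h), ?_⟩
          have : l ≠ i := by rintro rfl; exact hJ hl
          simp [hy, ee_ne this]
        · rintro J y ⟨hJ, hy⟩ l hl
          have : l ≠ i := by rintro rfl; exact hJ hl
          simp only [dl]
          rw [hc (y + ee l) y (by simp [hy, ee_ne this]) hy, sub_self]
      refine bx_side N (k+1) i (by omega) _ ?_ ?_ x (hx i (by omega))
      · intro y hy
        rw [key 0 _ y hy, mul_zero]
        intro y y' hy hy'
        rw [h0 i (by omega) y hy.le, h0 i (by omega) y' hy'.le]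
      · intro y hy
        rw [key N _ y hy, mul_zero]
        intro y y' hy hy'
        rw [hN i (by omega) y hy.ge, hN i (by omega) y' hy'.ge]

/-- Some unit cube is such that every `f j` is non-constant on it. -/
theorem exists_cube (N : ℕ) (f : ℕ → (ℕ → ℤ) → ZMod 2) (m : ℕ)
    (h0 : ∀ j < m, ∀ y, y j ≤ 0 → f j y = 0) (hN : ∀ j < m, ∀ y, (N : ℤ) ≤ y j → f j y = 1) :
    ∃ x : ℕ → ℤ, ∀ j < m, ∃ y z : ℕ → ℤ, (∀ i, x i ≤ y i ∧ y i ≤ x i + 1) ∧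
      (∀ i, x i ≤ z i ∧ z i ≤ x i + 1) ∧ f j y ≠ f j z := by
  by_contra hcon
  push Not at hcon
  have h1 := bx_eta N f m h0 hN m le_rfl 0 (by simp)
  have : eta f m (Finset.range m) = fun _ => 0 := by
    funext x
    obtain ⟨j, hj, h⟩ := hcon x
    refine eta_vanish f j
      (fun J y => ∀ i, x i ≤ y i ∧ y i ≤ x i + 1 ∧ (i ∈ J → y i = x i)) ?_ ?_ m hj _ x ?_
    · intro J y hP l hl i
      obtain ⟨a, b, c⟩ := hP i
      by_cases hil : l = i
      · subst hil
        simp [ee_self, c hl]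
      · simp only [Pi.add_apply, ee_ne hil, add_zero]
        exact ⟨a, b, fun h => c (Finset.mem_of_mem_erase h)⟩
    · intro J y hP l hl
      simp only [dl]
      rw [h (y + ee l) y ?_ ?_, sub_self]
      · intro i
        obtain ⟨a, b, c⟩ := hP i
        by_cases hil : l = i
        · subst hil
          simp [ee_self, c hl]
        · simp only [Pi.add_apply, ee_ne hil, add_zero]
          exact ⟨a, b⟩
      · exact fun i => ⟨(hP i).1, (hP i).2.1⟩
    · intro i; simp
  rw [this, bx_zero] at h1
  exact zero_ne_one h1

end AsdimHex
namespace AsdimHex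

theorem rank_tensor {A : Type*} [AddCommGroup A] :
    Module.rank ℚ (ℚ ⊗[ℤ] A) = Module.rank ℤ A := by
  rw [IsLocalization.rank_eq (R := ℤ) ℚ (nonZeroDivisors ℤ) le_rfl]
  have : IsLocalizedModule (nonZeroDivisors ℤ) (TensorProduct.mk ℤ ℚ A 1) :=
    (isLocalizedModule_iff_isBaseChange (nonZeroDivisors ℤ) ℚ _).2
      (TensorProduct.isBaseChange ℤ A ℚ)
  have h := @IsLocalizedModule.rank_eq ℤ A _ _ _ (nonZeroDivisors ℤ) le_rfl _ _ _
    (TensorProduct.mk ℤ ℚ A 1) this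
  convert h
  exact Subsingleton.elim _ _

/-- coordinates of `x` which are within `kD` of a multiple of `N` -/
def near (r : ℕ) (D N : ℤ) (k : ℕ) (x : Fin r → ℤ) : Finset (Fin r) :=
  Finset.univ.filter fun i => (x i + k * D) % N ≤ 2 * k * D

/-- The standard coloring of `ℤ^r` -/
theorem coloring (r : ℕ) (D : ℤ) (hD : 0 ≤ D) : ∃ (N : ℤ) (c : (Fin r → ℤ) → Fin (r + 1))
    (l : (Fin r → ℤ) → (Fin r → ℤ)),
    (∀ x y, c x = c y → (∀ i, |x i - y i| ≤ D) → l x = l y) ∧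
    (∀ x y, c x = c y → l x = l y → ∀ i, |x i - y i| ≤ N) := by
  obtain ⟨N, hNdef⟩ : ∃ N : ℤ, N = (2 * r + 4) * D + 1 := ⟨_, rfl⟩
  have hN : 0 < N := by rw [hNdef]; positivity
  let c : (Fin r → ℤ) → ℕ := fun x =>
    Nat.findGreatest (fun k => k ≤ (near r D N k x).card) r
  have hcr : ∀ x, c x ≤ r := fun x => Nat.findGreatest_le r
  have hc1 : ∀ x, c x ≤ (near r D N (c x) x).card := fun x =>
    Nat.findGreatest_spec (P := fun k => k ≤ (near r D N k x).card) (Nat.zero_le r)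
      (Nat.zero_le _)
  have hc2 : ∀ x, (near r D N (c x + 1) x).card ≤ c x := by
    intro x
    by_contra h
    push Not at h
    by_cases hr : c x + 1 ≤ r
    · have := Nat.findGreatest_is_greatest (P := fun k => k ≤ (near r D N k x).card)
        (Nat.lt_succ_self (c x)) hr
      exact this h
    · have := Finset.card_le_univ (near r D N (c x + 1) x)
      simp at this
      have := hcr x
      omega
  -- unfolding near
  have hne : ∀ k : ℕ, k ≤ r + 1 → ∀ (x : Fin r → ℤ) i, i ∈ near r D N k x ↔ ∃ a : ℤ, |x i - N * a| ≤ k * D := by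
    intro k hk x i
    have hkD : (k : ℤ) * D ≤ (r + 1) * D := by gcongr; exact_mod_cast hk
    have hkD0 : 0 ≤ (k : ℤ) * D := by positivity
    simp only [near, Finset.mem_filter, Finset.mem_univ, true_and]
    have e := Int.emod_add_mul_ediv (x i + k * D) N
    have p := Int.emod_nonneg (x i + k * D) hN.ne'
    constructor
    · intro h
      refine ⟨(x i + k * D) / N, ?_⟩
      rw [abs_le]; constructor <;> linarith
    · rintro ⟨a, ha⟩
      rw [abs_le] at ha
      have : (x i + k * D) = (x i + k * D - N * a) + N * a := by ring
      rw [this, Int.add_mul_emod_self_left, Int.emod_eq_of_lt] <;> linarith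
  have hsub : ∀ x, near r D N (c x) x = near r D N (c x + 1) x := by
    intro x
    refine Finset.eq_of_subset_of_card_le ?_ ((hc2 x).trans (hc1 x))
    intro i hi
    have := hcr x
    rw [hne _ (by omega)] at hi ⊢
    obtain ⟨a, ha⟩ := hi
    refine ⟨a, ha.trans ?_⟩
    push_cast
    linarith
  have hstep : ∀ x y, c x = c y → (∀ i, |x i - y i| ≤ D) →
      near r D N (c x) x ⊆ near r D N (c x) y := by
    intro x y hxy h i hi
    have := hcr x
    rw [hxy, hsub y, ← hxy]
    rw [hne _ (by omega)] at hi ⊢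
    obtain ⟨a, ha⟩ := hi
    refine ⟨a, ?_⟩
    have h := h i
    rw [abs_le] at *
    push_cast
    constructor <;> linarith
  refine ⟨N, fun x => ⟨c x, Nat.lt_succ_of_le (hcr x)⟩, fun x i => (x i + c x * D) / N, ?_, ?_⟩
  · intro x y hxy h
    have hxy : c x = c y := congrArg Fin.val hxy
    have hnn : near r D N (c x) x = near r D N (c x) y := by
      apply (hstep x y hxy h).antisymm
      have := hstep y x hxy.symm (fun i => by rw [abs_sub_comm]; exact h i)
      rwa [← hxy] at this
    funext i
    have hi := h i
    simp only [← hxy]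
    have hkr := hcr x
    have hnx := hsub x
    have hny := hsub y
    rw [← hxy] at hny
    generalize c x = k at *
    have hkD : (k : ℤ) * D ≤ r * D := by gcongr
    have hkD0 : 0 ≤ (k : ℤ) * D := by positivity
    rw [abs_le] at hi
    have ex := Int.emod_add_mul_ediv (x i + k * D) N
    have px := Int.emod_nonneg (x i + k * D) hN.ne'
    have qx := Int.emod_lt_of_pos (x i + k * D) hN
    have ey := Int.emod_add_mul_ediv (y i + k * D) N
    have py := Int.emod_nonneg (y i + k * D) hN.ne'
    have qy := Int.emod_lt_of_pos (y i + k * D) hN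
    have bx : i ∈ near r D N k x ↔ (x i + k * D) % N ≤ 2 * k * D := by simp [near]
    have byk : i ∈ near r D N k y ↔ (y i + k * D) % N ≤ 2 * k * D := by simp [near]
    by_cases hin : i ∈ near r D N k x
    · have hin' : i ∈ near r D N k y := hnn ▸ hin
      rw [bx] at hin
      rw [byk] at hin'
      generalize (x i + k * D) / N = a at *
      generalize (y i + k * D) / N = b at *
      rcases lt_trichotomy a b with hab | hab | hab
      · have : N * (a + 1) ≤ N * b := by gcongr; omega
        nlinarith
      · exact hab
      · have : N * (b + 1) ≤ N * a := by gcongr; omega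
        nlinarith
    · have hin' : i ∉ near r D N k y := hnn ▸ hin
      rw [hnx, hne _ (by omega)] at hin
      rw [hny, hne _ (by omega)] at hin'
      have hin0 := hin
      push Not at hin hin'
      have bx' : 2 * k * D < (x i + k * D) % N := by
        rw [← not_le, ← bx, hnx, hne _ (by omega)]; exact hin0
      have by2 : 2 * k * D < (y i + k * D) % N := by
        rw [← not_le, ← byk, ← hnn, hnx, hne _ (by omega)]; exact hin0
      generalize (x i + k * D) / N = a at *
      generalize (y i + k * D) / N = b at *
      push_cast at hin hin'
      rcases lt_trichotomy a b with hab | hab | hab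
      · exfalso
        have : N * (a + 1) ≤ N * b := by gcongr; omega
        have := hin b
        rw [lt_abs] at this
        rcases this with h | h <;> nlinarith
      · exact hab
      · exfalso
        have : N * (b + 1) ≤ N * a := by gcongr; omega
        have := hin' a
        rw [lt_abs] at this
        rcases this with h | h <;> nlinarith
  · intro x y hxy hl i
    have hxy : c x = c y := congrArg Fin.val hxy
    have hl := congrFun hl i
    simp only [← hxy] at hl
    have ex := Int.emod_add_mul_ediv (x i + c x * D) N
    have px := Int.emod_nonneg (x i + c x * D) hN.ne'
    have qx := Int.emod_lt_of_pos (x i + c x * D) hN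
    have ey := Int.emod_add_mul_ediv (y i + c x * D) N
    have py := Int.emod_nonneg (y i + c x * D) hN.ne'
    have qy := Int.emod_lt_of_pos (y i + c x * D) hN
    rw [hl] at ex
    rw [abs_le]; constructor <;> linarith

/-- A f.g. abelian group maps to `ℤ^r` with finite fibers over finite sets. -/
theorem exists_map (H : Type*) [AddCommGroup H] [AddGroup.FG H] :
    ∃ (r : ℕ) (ψ : H →+ (Fin r → ℤ)), (r : Cardinal) ≤ Module.rank ℤ H ∧
      ∀ s : Set (Fin r → ℤ), s.Finite → (ψ ⁻¹' s).Finite := by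
  obtain ⟨r, ι, _, p, hp, e, ⟨g⟩⟩ := AddCommGroup.equiv_free_prod_directSum_zmod H
  have : ∀ i, NeZero (p i ^ e i) := fun i => ⟨pow_ne_zero _ (hp i).ne_zero⟩
  classical
  have : Finite (DirectSum ι fun i => ZMod (p i ^ e i)) :=
    Finite.of_equiv _ (DirectSum.addEquivProd (fun i => ZMod (p i ^ e i))).symm.toEquiv
  let ev : (Fin r →₀ ℤ) →+ (Fin r → ℤ) := Finsupp.coeFnAddHom
  refine ⟨r, ev.comp ((AddMonoidHom.fst _ _).comp g.toAddMonoidHom), ?_, ?_⟩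
  · let j : (Fin r →₀ ℤ) →+ H := g.symm.toAddMonoidHom.comp (AddMonoidHom.inl _ _)
    have hj : Function.Injective j.toIntLinearMap := by
      intro a b h
      have := g.symm.injective h
      exact (Prod.mk.inj this).1
    have := LinearMap.lift_rank_le_of_injective _ hj
    simpa using this
  · intro s hs
    have h1 : (ev ⁻¹' s).Finite := hs.preimage DFunLike.coe_injective.injOn
    have h2 : ((ev ⁻¹' s) ×ˢ (Set.univ : Set (DirectSum ι fun i => ZMod (p i ^ e i)))).Finite :=
      h1.prod Set.finite_univ
    refine (h2.preimage g.injective.injOn).subset ?_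
    intro x hx
    exact ⟨hx, trivial⟩

theorem dist_bdd {A : Type*} [AddCommGroup A] [MetricSpace A] {s : Set A} (hs : s.Finite) :
    ∃ R : ℝ, 0 < R ∧ ∀ x ∈ s, dist 0 x ≤ R := by
  obtain ⟨M, hM⟩ := (hs.image (fun x => dist 0 x)).bddAbove
  exact ⟨max M 1, by positivity, fun x hx => (hM ⟨x, hx, rfl⟩).trans (le_max_left _ _)⟩

theorem upper {A : Type*} [AddCommGroup A] [MetricSpace A]
    (hinv : ∀ g x y : A, dist (g + x) (g + y) = dist x y)
    (hproper : ∀ (x : A) (r : ℝ), {y : A | dist x y ≤ r}.Finite) (n : ℕ)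
    (hn : Module.rank ℤ A ≤ n) : AsdimLE A n := by
  intro d hd
  have hdist : ∀ x y : A, dist x y = dist 0 (y - x) := by
    intro x y
    rw [← hinv x 0 (y - x)]; simp
  let S : Set A := {y : A | dist 0 y ≤ d}
  have hS : S.Finite := hproper 0 d
  let H : AddSubgroup A := AddSubgroup.closure S
  have hSH : ∀ s ∈ S, s ∈ H := fun s hs => AddSubgroup.subset_closure hs
  have : AddGroup.FG H := (AddGroup.fg_iff_addSubgroup_fg H).2 ⟨hS.toFinset, by simp [H]⟩
  obtain ⟨r, ψ, hr, hψ⟩ := exists_map H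
  have hrn : r ≤ n := by
    have h1 : Module.rank ℤ H ≤ Module.rank ℤ A :=
      LinearMap.rank_le_of_injective H.subtype.toIntLinearMap Subtype.val_injective
    exact_mod_cast hr.trans (h1.trans hn)
  obtain ⟨D, hD0, hD⟩ : ∃ D : ℤ, 0 ≤ D ∧ ∀ s : H, (s : A) ∈ S → ∀ i, |ψ s i| ≤ D := by
    have hf : {p : ℤ | ∃ s : H, (s : A) ∈ S ∧ ∃ i, p = |ψ s i|}.Finite := by
      have h1 : {s : H | (s : A) ∈ S}.Finite := hS.preimage Subtype.val_injective.injOn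
      refine ((h1.prod (Set.finite_univ (α := Fin r))).image (fun q => |ψ q.1 q.2|)).subset ?_
      rintro p ⟨s, hs, i, rfl⟩
      exact ⟨(s, i), ⟨hs, trivial⟩, rfl⟩
    obtain ⟨M, hM⟩ := hf.bddAbove
    exact ⟨max M 0, le_max_right _ _, fun s hs i => (hM ⟨s, hs, i, rfl⟩).trans (le_max_left _ _)⟩
  obtain ⟨N, c, l, hcl1, hcl2⟩ := coloring r D hD0
  -- representatives
  let rep : A → A := fun x => (QuotientAddGroup.mk x : A ⧸ H).out
  have hrep : ∀ x, x - rep x ∈ H := by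
    intro x
    have := QuotientAddGroup.mk_out_eq_add H x
    obtain ⟨h, hh⟩ := this
    simp only [rep, hh]
    simp
  have hreq : ∀ x y, y - x ∈ H → rep x = rep y := by
    intro x y h
    have : (QuotientAddGroup.mk x : A ⧸ H) = QuotientAddGroup.mk y := by
      rw [QuotientAddGroup.eq]
      rwa [neg_add_eq_sub]
    simp only [rep, this]
  let θ : A → (Fin r → ℤ) := fun x => ψ ⟨x - rep x, hrep x⟩
  have hθ : ∀ x y, rep x = rep y → ∃ h : y - x ∈ H, θ y - θ x = ψ ⟨y - x, h⟩ := by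
    intro x y h
    have hh : y - x ∈ H := by
      have := H.sub_mem (hrep y) (hrep x)
      rw [h] at this
      simpa using this
    refine ⟨hh, ?_⟩
    simp only [θ]
    rw [← map_sub]
    congr 1
    ext
    simp [h]
  let B : Set A := Set.image Subtype.val (Set.preimage ψ {v | ∀ i, |v i| ≤ N})
  have hB : B.Finite := by
    refine (hψ _ ?_).image _
    refine (Set.finite_Icc (fun _ : Fin r => -N) (fun _ => N)).subset ?_
    intro v hv
    exact ⟨fun i => (abs_le.1 (hv i)).1, fun i => (abs_le.1 (hv i)).2⟩
  obtain ⟨R, hR0, hR⟩ := dist_bdd hB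
  refine ⟨R, hR0, fun i => {U | ∃ (a : A) (L : Fin r → ℤ),
    U = {x | (c (θ x) : ℕ) = i ∧ rep x = a ∧ l (θ x) = L}}, ?_, ?_, ?_⟩
  · rintro i U ⟨a, L, rfl⟩ x ⟨hx1, hx2, hx3⟩ y ⟨hy1, hy2, hy3⟩
    rw [hdist]
    apply hR
    obtain ⟨h, e⟩ := hθ x y (hx2.trans hy2.symm)
    refine ⟨⟨y - x, h⟩, ?_, rfl⟩
    intro i
    rw [← e]
    exact hcl2 _ _ (Fin.ext (hy1.trans hx1.symm)) (hy3.trans hx3.symm) i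
  · rintro i U ⟨a, L, rfl⟩ V ⟨a', L', rfl⟩ hUV x ⟨hx1, hx2, hx3⟩ y ⟨hy1, hy2, hy3⟩
    by_contra hcon
    push Not at hcon
    apply hUV
    rw [hdist] at hcon
    have hs : y - x ∈ S := hcon
    have hrr := hreq x y (hSH _ hs)
    obtain ⟨h, e⟩ := hθ x y hrr
    have : l (θ y) = l (θ x) := by
      refine hcl1 _ _ (Fin.ext (hy1.trans hx1.symm)) fun i => ?_
      have := hD ⟨y - x, h⟩ hs i
      rw [← e] at this
      exact this
    have e1 : a = a' := by rw [← hx2, ← hy2, hrr]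
    have e2 : L = L' := by rw [← hx3, ← hy3, this]
    rw [e1, e2]
  · rw [Set.eq_univ_iff_forall]
    intro x
    rw [Set.mem_iUnion]
    exact ⟨⟨c (θ x), by omega⟩, _, ⟨rep x, l (θ x), rfl⟩, rfl, rfl, rfl⟩

end AsdimHex
namespace AsdimHex

theorem lower {A : Type*} [AddCommGroup A] [MetricSpace A]
    (hinv : ∀ g x y : A, dist (g + x) (g + y) = dist x y)
    (hproper : ∀ (x : A) (r : ℝ), {y : A | dist x y ≤ r}.Finite) (n : ℕ)
    (hA : AsdimLE A n) : Module.rank ℤ A ≤ n := by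
  by_contra hcon
  push Not at hcon
  have hcon' : ((n + 1 : ℕ) : Cardinal) ≤ Module.rank ℤ A := by
    have := Order.succ_le_of_lt hcon
    rw [Cardinal.succ_natCast] at this
    exact_mod_cast this
  obtain ⟨s, hs, hli⟩ := exists_finset_linearIndependent_of_le_rank hcon'
  let eqv : Fin (n + 1) ≃ s := (Fintype.equivFinOfCardEq (by simpa using hs)).symm
  let a : Fin (n + 1) → A := fun i => (eqv i : A)
  have ha : LinearIndependent ℤ a := hli.comp eqv eqv.injective
  have hdist : ∀ x y : A, dist x y = dist 0 (y - x) := by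
    intro x y
    rw [← hinv x 0 (y - x)]; simp
  let φfin : (Fin (n + 1) → ℤ) → A := fun v => ∑ i, v i • a i
  have hφinj : Function.Injective φfin := by
    intro v w h
    have h0 : ∑ i, (v i - w i) • a i = 0 := by
      simp only [sub_smul, Finset.sum_sub_distrib]
      exact sub_eq_zero.2 h
    funext i
    exact sub_eq_zero.1 (Fintype.linearIndependent_iff.1 ha _ h0 i)
  let φ : (ℕ → ℤ) → A := fun x => φfin (fun i => x i)
  have hφsub : ∀ x y, φ y - φ x = φfin (fun i => y i - x i) := by
    intro x y
    simp [φ, φfin, sub_smul, Finset.sum_sub_distrib]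
  -- choose d
  obtain ⟨d, hd0, hd⟩ := dist_bdd
    ((Set.finite_Icc (fun _ : Fin (n + 1) => (-2 : ℤ)) (fun _ => 2)).image φfin)
  obtain ⟨R, hR0, 𝒰, hb, hdj, hcov⟩ := hA d hd0
  have hch : ∀ x : A, ∃ (i : Fin (n + 1)) (U : Set A), U ∈ 𝒰 i ∧ x ∈ U := by
    intro x
    have : x ∈ ⋃ i, ⋃₀ 𝒰 i := by rw [hcov]; trivial
    rw [Set.mem_iUnion] at this
    obtain ⟨i, U, hU, hx⟩ := this
    exact ⟨i, U, hU, hx⟩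
  choose c l hl hxl using hch
  have h1 : ∀ x y, c x = c y → dist x y ≤ d → l x = l y := by
    intro x y hc hxy
    by_contra hne
    have := hdj (c x) (l x) (hl x) (l y) (hc ▸ hl y) hne x (hxl x) y (hxl y)
    linarith
  have h2 : ∀ x y, l x = l y → dist x y ≤ R := by
    intro x y h
    exact hb (c x) (l x) (hl x) x (hxl x) y (h ▸ hxl y)
  -- bound
  obtain ⟨N0, hN0⟩ : ∃ N0 : ℕ, ∀ x y, l (φ x) = l (φ y) → ∀ j < n + 1, |y j - x j| ≤ N0 := by
    have hf : (φfin ⁻¹' {y : A | dist 0 y ≤ R}).Finite := (hproper 0 R).preimage hφinj.injOn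
    have hf2 := (hf.prod (Set.finite_univ (α := Fin (n + 1)))).image (fun q => (q.1 q.2).natAbs)
    obtain ⟨M, hM⟩ := hf2.bddAbove
    refine ⟨M, fun x y hxy j hj => ?_⟩
    have h3 := h2 _ _ hxy
    rw [hdist, hφsub] at h3
    have : (y j - x j).natAbs ≤ M :=
      hM ⟨((fun i : Fin (n + 1) => y i - x i), (⟨j, hj⟩ : Fin (n + 1))), ⟨h3, trivial⟩, rfl⟩
    rw [Int.abs_eq_natAbs]
    exact_mod_cast this
  let N : ℕ := N0 + 3
  -- high points
  let Hi : ℕ → (ℕ → ℤ) → Prop := fun j y => (c (φ y) : ℕ) = j ∧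
    ∃ z : ℕ → ℤ, (N : ℤ) - 1 ≤ z j ∧ l (φ z) = l (φ y)
  let Q : ℕ → (ℕ → ℤ) → Prop := fun j x => (N : ℤ) ≤ x j ∨
    ∃ y, (∀ i < n + 1, |y i - x i| ≤ 1) ∧ Hi j y
  classical
  let f : ℕ → (ℕ → ℤ) → ZMod 2 := fun j x => if Q j x then 1 else 0
  obtain ⟨x, hx⟩ := exists_cube N f (n + 1)
    (by
      intro j hj y hy
      have : ¬ Q j y := by
        rintro (h | ⟨w, hw, hc, z, hz, hzl⟩)
        · have : (N : ℤ) = N0 + 3 := by simp [N]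
          omega
        · have e : (N : ℤ) = N0 + 3 := by simp [N]
          have h3 := abs_le.1 (hN0 _ _ hzl j hj)
          have h4 := abs_le.1 (hw j hj)
          omega
      simp [f, this])
    (by
      intro j hj y hy
      have : Q j y := Or.inl hy
      simp [f, this])
  obtain ⟨y, z, hy, hz, hyz⟩ := hx (c (φ x)) (c (φ x)).2
  apply hyz
  by_cases hH : Hi (c (φ x)) x
  · have hall : ∀ w : ℕ → ℤ, (∀ i, x i ≤ w i ∧ w i ≤ x i + 1) → Q (c (φ x)) w := by
      intro w hw
      refine Or.inr ⟨x, fun i _ => ?_, hH⟩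
      have := hw i
      rw [abs_le]; constructor <;> linarith
    simp only [f, hall y hy, hall z hz]
  · have hall : ∀ w : ℕ → ℤ, (∀ i, x i ≤ w i ∧ w i ≤ x i + 1) → ¬ Q (c (φ x)) w := by
      rintro w hw (h | ⟨v, hv, hc, u, hu, hul⟩)
      · apply hH
        refine ⟨rfl, x, ?_, rfl⟩
        have := hw (c (φ x))
        linarith
      · apply hH
        refine ⟨rfl, u, hu, hul.trans ?_⟩
        refine h1 _ _ (Fin.ext hc) ?_
        rw [hdist, hφsub]
        apply hd
        refine ⟨_, ⟨fun i => ?_, fun i => ?_⟩, rfl⟩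
        · have h3 := hw i
          have h4 := abs_le.1 (hv i i.2)
          simp only
          linarith
        · have h3 := hw i
          have h4 := abs_le.1 (hv i i.2)
          simp only
          linarith
    simp only [f, hall y hy, hall z hz]

theorem asdim_eq {A : Type*} [AddCommGroup A] [MetricSpace A]
    (hinv : ∀ g x y : A, dist (g + x) (g + y) = dist x y)
    (hproper : ∀ (x : A) (r : ℝ), {y : A | dist x y ≤ r}.Finite) :
    asdim A = Cardinal.toENat (Module.rank ℚ (ℚ ⊗[ℤ] A)) := by
  have key : ∀ n : ℕ, AsdimLE A n ↔ Cardinal.toENat (Module.rank ℚ (ℚ ⊗[ℤ] A)) ≤ n := by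
    intro n
    rw [rank_tensor, Cardinal.toENat_le_natCast]
    exact ⟨lower hinv hproper n, upper hinv hproper n⟩
  apply le_antisymm
  · generalize hr : Cardinal.toENat (Module.rank ℚ (ℚ ⊗[ℤ] A)) = r at *
    induction r using ENat.recTopCoe with
    | top => exact le_top
    | coe r => exact sInf_le ⟨r, rfl, (key r).2 le_rfl⟩
  · refine le_sInf ?_
    rintro m ⟨n, rfl, hn⟩
    exact (key n).1 hn

end AsdimHex

/-- For a countable abelian group `A` with a proper left invariant
metric, `asdim A = dim_ℚ (A ⊗_ℤ ℚ)`, where both sides may be infinite: `asdim A = n ∈ ℕ`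
iff the `ℚ`-vector space `A ⊗_ℤ ℚ` has dimension `n`, and `asdim A = ∞` iff `A ⊗_ℤ ℚ` is
infinite dimensional. -/
theorem asdim_abelian_eq_rank_tensor_rat {A : Type*} [AddCommGroup A] [Countable A]
    [MetricSpace A]
    (hinv : ∀ g x y : A, dist (g + x) (g + y) = dist x y)
    (hproper : ∀ (x : A) (r : ℝ), {y : A | dist x y ≤ r}.Finite) :
    (∀ n : ℕ, asdim A = (n : ℕ∞) ↔ Module.rank ℚ (ℚ ⊗[ℤ] A) = n) ∧
    (asdim A = ⊤ ↔ Cardinal.aleph0 ≤ Module.rank ℚ (ℚ ⊗[ℤ] A)) := by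
  rw [AsdimHex.asdim_eq hinv hproper]
  exact ⟨fun n => Cardinal.toENat_eq_natCast, Cardinal.toENat_eq_top⟩
end

section
/- Let 0 → B → A → C → 0 be a short exact sequence of countable abelian groups, each equipped with a proper left invariant metric. Then asdim A = asdim B + asdim C. In particular, asdim(A × B) = asdim A + asdim B for countable abelian groups A and B. -/
open Equiv

def vtx {m : ℕ} (x : Fin m → ℕ) (σ : Perm (Fin m)) (k : ℕ) : Fin m → ℕ :=
  fun i => x i + if (σ i : ℕ) < k then 1 else 0

def labMat {n : ℕ} (L : Fin n → ℕ) (off : ℕ) : Matrix (Fin n) (Fin n) (ZMod 2) :=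
  Matrix.of fun k j => if L k = (j : ℕ) + off then 1 else 0

lemma labMat_det_zero {n : ℕ} (L : Fin n → ℕ) (off : ℕ) (j : Fin n)
    (h : ∀ k, L k ≠ (j : ℕ) + off) : (labMat L off).det = 0 := by
  apply Matrix.det_eq_zero_of_column_eq_zero j
  intro k
  simp [labMat, h k]

lemma labMat_expand {m : ℕ} (L : Fin (m + 1) → ℕ) (hL : ∀ k, L k ≤ m) :
    (labMat L 0).det = ∑ k : Fin (m + 1), (labMat (fun j => L (k.succAbove j)) 1).det := by
  have h1 := Matrix.det_updateCol_sum (labMat L 0) 0 (fun _ => 1)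
  simp only [one_smul] at h1
  rw [← h1, Matrix.det_succ_column_zero]
  refine Finset.sum_congr rfl fun k _ => ?_
  have h2 : ((-1 : ZMod 2)) = 1 := by decide
  rw [h2, one_pow, one_mul, Matrix.updateCol_self]
  have h3 : ∑ i, labMat L 0 k i = 1 := by
    rw [Finset.sum_eq_single (⟨L k, Nat.lt_succ_of_le (hL k)⟩ : Fin (m + 1))]
    · simp [labMat]
    · intro b _ hb
      simp only [labMat, Matrix.of_apply, add_zero]
      rw [if_neg]
      intro h
      exact hb (Fin.ext h.symm)
    · simp
  rw [h3, one_mul]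
  rfl

lemma telescope {m N : ℕ} (i : Fin (m + 1)) (g : (Fin (m + 1) → ℕ) → ZMod 2) :
    ∑ x : Fin (m + 1) → Fin N,
      (g (fun j => (x j : ℕ) + if j = i then 1 else 0) + g (fun j => (x j : ℕ))) =
    ∑ y : Fin m → Fin N, (g (i.insertNth (α := fun _ => ℕ) N (fun j => (y j : ℕ))) +
      g (i.insertNth (α := fun _ => ℕ) 0 (fun j => (y j : ℕ)))) := by
  rw [← (Fin.insertNthEquiv (fun _ => Fin N) i).sum_comp, Fintype.sum_prod_type,
    Finset.sum_comm]
  refine Finset.sum_congr rfl fun y _ => ?_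
  have e1 : ∀ p : Fin N, (fun j => ((Fin.insertNthEquiv (fun _ => Fin N) i (p, y) j : Fin N) : ℕ)
      + if j = i then 1 else 0)
      = i.insertNth (α := fun _ => ℕ) ((p : ℕ) + 1) (fun j => (y j : ℕ)) := by
    intro p
    funext j
    refine Fin.succAboveCases i ?_ (fun j => ?_) j <;> simp
  have e2 : ∀ p : Fin N, (fun j => ((Fin.insertNthEquiv (fun _ => Fin N) i (p, y) j : Fin N) : ℕ))
      = i.insertNth (α := fun _ => ℕ) (p : ℕ) (fun j => (y j : ℕ)) := by
    intro p
    funext j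
    refine Fin.succAboveCases i ?_ (fun j => ?_) j <;> simp
  simp only [e1, e2]
  rw [Fin.sum_univ_eq_sum_range (fun p => g (i.insertNth (α := fun _ => ℕ) (p + 1) (fun j => (y j : ℕ)))
    + g (i.insertNth (α := fun _ => ℕ) p (fun j => (y j : ℕ)))) N]
  have := Finset.sum_range_sub (fun p => g (i.insertNth (α := fun _ => ℕ) p (fun j => (y j : ℕ)))) N
  simpa only [CharTwo.sub_eq_add] using this

/-- interior facets cancel -/
lemma swap_cancel {m : ℕ} (ℓ : (Fin (m + 1) → ℕ) → ℕ) (x : Fin (m + 1) → ℕ) (j : Fin m) :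
    ∑ σ : Perm (Fin (m + 1)),
      (labMat (fun t : Fin (m + 1) => ℓ (vtx x σ ((j.castSucc.succ).succAbove t : Fin (m + 2)))) 1).det
      = 0 := by
  refine Finset.sum_involution (fun σ _ => Equiv.swap j.castSucc j.succ * σ) ?_ ?_ ?_ ?_
  · intro σ _
    have : ∀ t : Fin (m + 1), vtx x (Equiv.swap j.castSucc j.succ * σ) ((j.castSucc.succ).succAbove t : Fin (m + 2))
       = vtx x σ ((j.castSucc.succ).succAbove t : Fin (m + 2)) := by
      intro t
      have hne : (((j.castSucc.succ).succAbove t : Fin (m + 2)) : ℕ) ≠ (j : ℕ) + 1 := by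
        intro h
        exact Fin.succAbove_ne (j.castSucc.succ) t (Fin.ext (by simpa using h))
      generalize (((j.castSucc.succ).succAbove t : Fin (m + 2)) : ℕ) = k at hne
      funext i
      refine congrArg (x i + ·) (if_congr ?_ rfl rfl)
      rw [Perm.mul_apply, Equiv.swap_apply_def]
      split_ifs <;> simp_all <;> omega
    simp only [this]
    exact CharTwo.add_self_eq_zero _
  · intro σ _ _ h
    have h2 : Equiv.swap j.castSucc j.succ = 1 := by simpa using h
    rw [Equiv.swap_eq_one_iff] at h2
    have := congrArg Fin.val h2
    simp at this
  · intro σ _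
    exact Finset.mem_univ _
  · intro σ _
    simp

def fG {m : ℕ} (ℓ : (Fin (m + 1) → ℕ) → ℕ) (σ : Perm (Fin (m + 1))) (y : Fin (m + 1) → ℕ) : ZMod 2 :=
  (labMat (fun t : Fin (m + 1) => ℓ (fun i => y i + if 1 ≤ (σ i : ℕ) ∧ (σ i : ℕ) < (t : ℕ) + 1 then 1 else 0)) 1).det

theorem sperner (m : ℕ) : ∀ (N : ℕ) (_ : 0 < N) (ℓ : (Fin m → ℕ) → ℕ)
    (_ : ∀ (x : Fin m → ℕ) (i : Fin m), (∀ j, x j ≤ N) → x i = 0 → ℓ x ≠ (i : ℕ) + 1)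
    (_ : ∀ (x : Fin m → ℕ) (i : Fin m), (∀ j, x j ≤ N) → x i = N → (i : ℕ) + 1 ≤ ℓ x)
    (_ : ∀ x, (∀ j, x j ≤ N) → ℓ x ≤ m),
    ∑ x : Fin m → Fin N, ∑ σ : Perm (Fin m),
      (labMat (fun k : Fin (m + 1) => ℓ (vtx (fun i => (x i : ℕ)) σ k)) 0).det = 1 := by
  induction m with
  | zero =>
    intro N hN ℓ h0 h1 hle
    have : ∀ x, ℓ x = 0 := fun x => Nat.le_zero.mp (hle x (fun j => j.elim0))
    simp [labMat, this]
  | succ m ih =>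
    intro N hN ℓ h0 h1 hle
    have hv : ∀ (x : Fin (m + 1) → Fin N) σ k j, vtx (fun i => (x i : ℕ)) σ k j ≤ N := by
      intro x σ k j
      have := (x j).2
      simp only [vtx]
      split_ifs <;> omega
    have step1 : ∀ x : Fin (m + 1) → Fin N, ∑ σ : Perm (Fin (m + 1)),
        (labMat (fun k : Fin (m + 2) => ℓ (vtx (fun i => (x i : ℕ)) σ k)) 0).det
        = ∑ σ : Perm (Fin (m + 1)), (fG ℓ σ (fun j => (x j : ℕ) + if j = σ.symm 0 then 1 else 0)
            + fG ℓ σ (fun j => (x j : ℕ))) := by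
      intro x
      rw [Finset.sum_congr rfl (fun σ _ => labMat_expand _ (fun k => hle _ (hv x σ k)))]
      rw [Finset.sum_comm, Fin.sum_univ_succ, Fin.sum_univ_castSucc, Finset.sum_add_distrib]
      have hmid : ∑ j : Fin m, ∑ σ : Perm (Fin (m + 1)),
          (labMat (fun t : Fin (m + 1) => ℓ (vtx (fun i => (x i : ℕ)) σ ((j.castSucc.succ).succAbove t : Fin (m + 2)))) 1).det = 0 :=
        Finset.sum_eq_zero fun j _ => swap_cancel ℓ _ j
      rw [hmid, zero_add]
      congr 1
      · refine Finset.sum_congr rfl fun σ _ => ?_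
        unfold fG
        congr 2
        funext t
        congr 1
        funext i
        simp only [vtx, Fin.succAbove_zero, Fin.val_succ]
        by_cases hi : i = σ.symm 0
        · subst hi
          simp
        · have : (σ i : ℕ) ≠ 0 := by
            intro h
            apply hi
            rw [Equiv.eq_symm_apply]
            exact Fin.ext h
          have : 1 ≤ (σ i : ℕ) := by omega
          simp [hi, this]
      · rw [← Equiv.sum_comp (Equiv.mulLeft (finRotate (m + 1))⁻¹)]
        refine Finset.sum_congr rfl fun σ _ => ?_
        unfold fG
        congr 2
        funext t
        congr 1
        funext i
        refine congrArg ((x i : ℕ) + ·) (if_congr ?_ rfl rfl)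
        rw [Equiv.coe_mulLeft, Perm.mul_apply]
        have hq : σ i = finRotate (m + 1) ((finRotate (m + 1))⁻¹ (σ i)) := by simp
        generalize (finRotate (m + 1))⁻¹ (σ i) = q at hq
        rw [hq, coe_finRotate]
        have ht := t.2
        have hqq := q.2
        have : ((Fin.last m).succ.succAbove t : ℕ) = t := by
          rw [Fin.succ_last, Fin.succAbove_last]; rfl
        rw [this]
        split_ifs <;> simp_all <;> omega
    rw [Finset.sum_congr rfl (fun x _ => step1 x), Finset.sum_comm]
    rw [Finset.sum_congr rfl (fun σ _ => telescope (σ.symm 0) (fG ℓ σ))]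
    -- bounds for vertices on faces
    have hb : ∀ (σ : Perm (Fin (m + 1))) (c : ℕ) (hc : c ≤ N) (y : Fin m → Fin N) (t : ℕ) (j : Fin (m + 1)),
        ((σ.symm 0).insertNth (α := fun _ => ℕ) c (fun j => (y j : ℕ)) : Fin (m + 1) → ℕ) j
          + (if 1 ≤ (σ j : ℕ) ∧ (σ j : ℕ) < t + 1 then 1 else 0) ≤ N := by
      intro σ c hc y t j
      by_cases hj : j = σ.symm 0
      · subst hj; simpa using hc
      · obtain ⟨j', rfl⟩ := Fin.exists_succAbove_eq hj
        rw [Fin.insertNth_apply_succAbove]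
        have := (y j').2
        split_ifs <;> omega
    have hz : ∀ (σ : Perm (Fin (m + 1))) (y : Fin m → Fin N),
        fG ℓ σ ((σ.symm 0).insertNth (α := fun _ => ℕ) 0 (fun j => (y j : ℕ))) = 0 := by
      intro σ y
      apply labMat_det_zero _ _ (σ.symm 0)
      intro k
      apply h0 _ (σ.symm 0) (hb σ 0 (Nat.zero_le _) y k)
      simp
    have hN' : ∀ (σ : Perm (Fin (m + 1))) (y : Fin m → Fin N), σ 0 ≠ 0 →
        fG ℓ σ ((σ.symm 0).insertNth (α := fun _ => ℕ) N (fun j => (y j : ℕ))) = 0 := by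
      intro σ y hσ
      apply labMat_det_zero _ _ 0
      intro k
      have := h1 _ (σ.symm 0) (hb σ N le_rfl y k) (by simp)
      have h3 : ((σ.symm 0 : Fin (m + 1)) : ℕ) ≠ 0 := by
        intro h
        apply hσ
        have : σ.symm 0 = 0 := Fin.ext h
        rw [Equiv.symm_apply_eq] at this
        exact this.symm
      simp only [Fin.val_zero]
      omega
    simp only [hz, add_zero]
    rw [← (Equiv.Perm.decomposeFin (n := m)).symm.sum_comp, Fintype.sum_prod_type, Fintype.sum_eq_single 0]
    swap
    · intro p hp
      refine Finset.sum_eq_zero fun τ _ => Finset.sum_eq_zero fun y _ => hN' _ _ (by simpa using hp)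
    have hbc : ∀ (x : Fin m → ℕ), (∀ j, x j ≤ N) → ∀ j, (Fin.cons N x : Fin (m + 1) → ℕ) j ≤ N := by
      intro x hx j
      refine Fin.cases ?_ (fun j => ?_) j
      · simp
      · simpa using hx j
    have key := ih N hN (fun x => ℓ (Fin.cons N x) - 1) ?_ ?_ ?_
    · rw [← key, Finset.sum_comm]
      refine Finset.sum_congr rfl fun y _ => Finset.sum_congr rfl fun τ _ => ?_
      have h00 : (Equiv.Perm.decomposeFin.symm ((0 : Fin (m + 1)), τ)).symm 0 = 0 := by
        rw [Equiv.symm_apply_eq]; simp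
      have hbb := hb (Equiv.Perm.decomposeFin.symm ((0 : Fin (m + 1)), τ)) N le_rfl y
      rw [h00] at hbb ⊢
      unfold fG
      congr 1
      ext k j
      have hk := h1 _ 0 (hbb k) (by simp)
      have heq : (fun i => (Fin.insertNth (α := fun _ => ℕ) 0 N (fun j => (y j : ℕ)) : Fin (m + 1) → ℕ) i +
        if 1 ≤ ((Equiv.Perm.decomposeFin.symm ((0 : Fin (m + 1)), τ)) i : ℕ) ∧ ((Equiv.Perm.decomposeFin.symm ((0 : Fin (m + 1)), τ)) i : ℕ) < (k : ℕ) + 1 then 1 else 0)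
        = Fin.cons N (vtx (fun i => (y i : ℕ)) τ k) := by
        funext i
        refine Fin.cases ?_ (fun i => ?_) i
        · simp
        · simp [vtx]
      rw [heq] at hk
      simp only [labMat, Matrix.of_apply, heq]
      simp only [Fin.val_zero] at hk
      congr 1
      apply propext
      omega
    · intro x i hx hi
      have := h0 (Fin.cons N x) i.succ (hbc x hx) (by simpa using hi)
      have h2 := h1 (Fin.cons N x) 0 (hbc x hx) (by simp)
      simp at this h2
      simp; omega
    · intro x i hx hi
      have := h1 (Fin.cons N x) i.succ (hbc x hx) (by simpa using hi)
      simp at this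
      simp; omega
    · intro x hx
      have := hle (Fin.cons N x) (hbc x hx)
      simp; omega

theorem sperner_exists (m N : ℕ) (hN : 0 < N) (ℓ : (Fin m → ℕ) → ℕ)
    (h0 : ∀ (x : Fin m → ℕ) (i : Fin m), (∀ j, x j ≤ N) → x i = 0 → ℓ x ≠ (i : ℕ) + 1)
    (h1 : ∀ (x : Fin m → ℕ) (i : Fin m), (∀ j, x j ≤ N) → x i = N → (i : ℕ) + 1 ≤ ℓ x)
    (hle : ∀ x, (∀ j, x j ≤ N) → ℓ x ≤ m) :
    ∃ (x : Fin m → ℕ) (σ : Perm (Fin m)),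
      Function.Injective (fun k : Fin (m + 1) => ℓ (vtx x σ k)) := by
  have h := sperner m N hN ℓ h0 h1 hle
  obtain ⟨x, _, hx⟩ := Finset.exists_ne_zero_of_sum_ne_zero (h.trans_ne one_ne_zero)
  obtain ⟨σ, _, hσ⟩ := Finset.exists_ne_zero_of_sum_ne_zero hx
  refine ⟨fun i => (x i : ℕ), σ, ?_⟩
  have hs : ∀ j : Fin (m + 1), ∃ k : Fin (m + 1), ℓ (vtx (fun i => (x i : ℕ)) σ k) = (j : ℕ) := by
    intro j
    by_contra! hc
    exact hσ (labMat_det_zero _ _ j (by simpa using hc))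
  choose u hu using hs
  have hui : Function.Injective u := by
    intro a b hab
    apply Fin.ext
    rw [← hu a, ← hu b, hab]
  have hub := Finite.surjective_of_injective hui
  intro a b hab
  obtain ⟨a', rfl⟩ := hub a
  obtain ⟨b', rfl⟩ := hub b
  simp only [hu] at hab
  rw [Fin.ext hab]

lemma dist_eq_zero_sub {A : Type*} [AddCommGroup A] [MetricSpace A]
    (hinv : ∀ g x y : A, dist (g + x) (g + y) = dist x y) (x y : A) :
    dist x y = dist 0 (y - x) := by
  have := hinv x 0 (y - x)
  simpa using this

theorem rank_le_of_asdimLE {A : Type*} [AddCommGroup A] [MetricSpace A]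
    (hinv : ∀ g x y : A, dist (g + x) (g + y) = dist x y)
    (hproper : ∀ (x : A) (r : ℝ), {y : A | dist x y ≤ r}.Finite) (n : ℕ)
    (h : AsdimLE A n) : Module.rank ℤ A ≤ n := by
  classical
  by_contra hlt
  have hle : ((n + 1 : ℕ) : Cardinal) ≤ Module.rank ℤ A := by
    have := Order.succ_le_of_lt (not_le.mp hlt)
    simpa using this
  obtain ⟨v, hv⟩ := Module.le_rank_iff.mp hle
  set ι : (Fin (n + 1) → ℤ) →ₗ[ℤ] A := Fintype.linearCombination ℤ v with hι
  have hinj : Function.Injective ι := hv.fintypeLinearCombination_injective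
  -- scale d
  have hfin : (Set.pi Set.univ (fun _ : Fin (n + 1) => Set.Icc (-1 : ℤ) 1)).Finite :=
    Set.Finite.pi fun _ => Set.finite_Icc _ _
  obtain ⟨d, hd⟩ := (hfin.image (fun w => dist (0 : A) (ι w))).bddAbove
  have hd' : ∀ w : Fin (n + 1) → ℤ, (∀ i, -1 ≤ w i ∧ w i ≤ 1) → dist 0 (ι w) ≤ d := by
    intro w hw
    exact hd ⟨w, fun i _ => hw i, rfl⟩
  obtain ⟨R, hR, 𝒰, hbd, hdis, hcov⟩ := h (max d 1) (by positivity)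
  have hmem : ∀ a : A, ∃ c : Fin (n + 1), ∃ U ∈ 𝒰 c, a ∈ U := by
    intro a
    have : a ∈ (⋃ i, ⋃₀ 𝒰 i) := by rw [hcov]; trivial
    simpa using this
  choose c U hU haU using hmem
  -- N
  have hfin2 : {w : Fin (n + 1) → ℤ | dist 0 (ι w) ≤ R}.Finite :=
    (hproper 0 R).preimage hinj.injOn
  obtain ⟨N, hN⟩ : ∃ N : ℕ, ∀ w : Fin (n + 1) → ℤ, dist 0 (ι w) ≤ R → ∀ i, w i < N := by
    obtain ⟨M, hM⟩ := (hfin2.image (fun w => ∑ i, |w i|)).bddAbove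
    refine ⟨(M + 1).toNat, fun w hw i => ?_⟩
    have h1 : ∑ i, |w i| ≤ M := hM ⟨w, hw, rfl⟩
    have h2 : |w i| ≤ ∑ i, |w i| :=
      Finset.single_le_sum (f := fun i => |w i|) (fun i _ => abs_nonneg _) (Finset.mem_univ i)
    have h3 := le_abs_self (w i)
    omega
  have hNpos : 0 < N := by
    have := hN 0 (by simpa using hR.le) 0
    simpa using this
  -- labels
  let emb : (Fin (n + 1) → ℕ) → A := fun x => ι (fun i => (x i : ℤ))
  let lam : Set A → Fin (n + 1) → Prop := fun S i => ∃ y : Fin (n + 1) → ℤ, ι y ∈ S ∧ (N : ℤ) ≤ y i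
  let labS : Set A → ℕ := fun S => (Finset.univ.filter (lam S)).sup (fun i => (i : ℕ) + 1)
  have hsp := sperner_exists (n + 1) N hNpos (fun x => labS (U (emb x))) ?_ ?_ ?_
  · -- pigeonhole
    obtain ⟨x, σ, hxσ⟩ := hsp
    obtain ⟨k, k', hkk, hc⟩ := Fintype.exists_ne_map_eq_of_card_lt
      (fun k : Fin (n + 2) => c (emb (vtx x σ k))) (by simp)
    apply hkk
    apply hxσ
    show labS (U (emb (vtx x σ k))) = labS (U (emb (vtx x σ k')))
    congr 1
    by_contra hne
    have hU' := hU (emb (vtx x σ k'))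
    rw [← hc] at hU'
    have h1 := hdis _ _ (hU (emb (vtx x σ k))) _ hU' hne _ (haU _) _ (haU _)
    rw [dist_eq_zero_sub hinv] at h1
    have h2 : emb (vtx x σ k') - emb (vtx x σ k) =
        ι (fun i => ((vtx x σ k' i : ℕ) : ℤ) - (vtx x σ k i : ℕ)) := by
      simp only [emb]
      rw [← map_sub]; rfl
    rw [h2] at h1
    have h3 := hd' (fun i => ((vtx x σ k' i : ℕ) : ℤ) - (vtx x σ k i : ℕ)) (by
      intro i
      simp only [vtx]
      split_ifs <;> push_cast <;> constructor <;> omega)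
    have := le_max_left d 1
    linarith
  · intro x i hx hi hlab
    have hpos : (Finset.univ.filter (lam (U (emb x)))).Nonempty := by
      rw [Finset.nonempty_iff_ne_empty]
      intro he
      simp [labS, he] at hlab
    obtain ⟨j, hj, hj2⟩ := Finset.exists_mem_eq_sup _ hpos (fun i : Fin (n + 1) => (i : ℕ) + 1)
    have hji : j = i := by
      apply Fin.ext
      have : (i : ℕ) + 1 = (j : ℕ) + 1 := hlab.symm.trans hj2
      omega
    subst hji
    obtain ⟨y, hy, hyN⟩ := (Finset.mem_filter.mp hj).2
    have h1 := hbd _ _ (hU (emb x)) _ (haU _) _ hy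
    rw [dist_eq_zero_sub hinv] at h1
    have h2 : ι y - emb x = ι (fun i => y i - (x i : ℤ)) := by
      simp only [emb]; rw [← map_sub]; rfl
    rw [h2] at h1
    have := hN _ h1 j
    simp only [hi] at this
    push_cast at this
    omega
  · intro x i hx hi
    apply Finset.le_sup (f := fun i : Fin (n + 1) => (i : ℕ) + 1)
    rw [Finset.mem_filter]
    exact ⟨Finset.mem_univ _, _, haU (emb x), by simp [hi]⟩
  · intro x hx
    apply Finset.sup_le
    intro i _
    exact i.2

lemma bad_unique (n : ℕ) (s : ℤ) (hs : 0 < s) (x : ℤ) (j j' : Fin (n + 1))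
    (h : ((n : ℤ) + 1) * s - s ≤ (x - j * s) % (((n : ℤ) + 1) * s))
    (h' : ((n : ℤ) + 1) * s - s ≤ (x - j' * s) % (((n : ℤ) + 1) * s)) : j = j' := by
  have hL : 0 < ((n : ℤ) + 1) * s := by positivity
  have a1 := Int.emod_lt_of_pos (x - j * s) hL
  have a2 := Int.emod_lt_of_pos (x - j' * s) hL
  have b1 := Int.mul_ediv_add_emod (x - j * s) (((n : ℤ) + 1) * s)
  have b2 := Int.mul_ediv_add_emod (x - j' * s) (((n : ℤ) + 1) * s)
  set u := (x - j * s) % (((n : ℤ) + 1) * s)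
  set u' := (x - j' * s) % (((n : ℤ) + 1) * s)
  set q := (x - j * s) / (((n : ℤ) + 1) * s)
  set q' := (x - j' * s) / (((n : ℤ) + 1) * s)
  have e : s * (((n : ℤ) + 1) * (q - q') + (j - j')) = u' - u := by linear_combination b1 - b2
  have e1 : ((n : ℤ) + 1) * (q - q') + (j - j') = 0 := by
    have l1 : u' - u < s := by linarith
    have l2 : -s < u' - u := by linarith
    rw [← e] at l1 l2
    have m1 : ((n : ℤ) + 1) * (q - q') + (j - j') < 1 := by
      by_contra hc
      push Not at hc
      nlinarith
    have m2 : -1 < ((n : ℤ) + 1) * (q - q') + (j - j') := by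
      by_contra hc
      push Not at hc
      nlinarith
    omega
  have hj := j.2
  have hj' := j'.2
  have e2 : q - q' = 0 := by
    have m1 : q - q' < 1 := by
      by_contra hc
      push Not at hc
      have : ((n : ℤ) + 1) * 1 ≤ ((n : ℤ) + 1) * (q - q') := by gcongr
      omega
    have m2 : -1 < q - q' := by
      by_contra hc
      push Not at hc
      have : ((n : ℤ) + 1) * (q - q') ≤ ((n : ℤ) + 1) * (-1) := by gcongr
      omega
    omega
  rw [e2, mul_zero] at e1
  apply Fin.ext
  omega

lemma good_far (L s x y : ℤ) (hL : 0 < L) (hx : x % L < L - s) (hy : y % L < L - s)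
    (h : |y - x| ≤ s) : x / L = y / L := by
  have b1 := Int.mul_ediv_add_emod x L
  have b2 := Int.mul_ediv_add_emod y L
  have a1 := Int.emod_nonneg x hL.ne'
  have a2 := Int.emod_nonneg y hL.ne'
  rw [abs_le] at h
  rcases lt_trichotomy (x / L) (y / L) with hlt | heq | hlt
  · have : L * (x / L + 1) ≤ L * (y / L) := by gcongr; omega
    nlinarith
  · exact heq
  · have : L * (y / L + 1) ≤ L * (x / L) := by gcongr; omega
    nlinarith

lemma exists_hom_of_fg (H : Type*) [AddCommGroup H] [AddGroup.FG H] :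
    ∃ (r : ℕ) (π : H →+ (Fin r → ℤ)), (r : Cardinal) ≤ Module.rank ℤ H ∧
      ∀ S : Set (Fin r → ℤ), S.Finite → (π ⁻¹' S).Finite := by
  obtain ⟨r, ι, _, p, hp, e, ⟨E⟩⟩ := AddCommGroup.equiv_free_prod_directSum_zmod H
  classical
  have hne : ∀ i, NeZero (p i ^ e i) := fun i => ⟨pow_ne_zero _ (hp i).ne_zero⟩
  have hfinT : Finite (DirectSum ι fun i => ZMod (p i ^ e i)) :=
    Finite.of_equiv _ (DirectSum.addEquivProd (fun i => ZMod (p i ^ e i))).symm.toEquiv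
  let co : (Fin r →₀ ℤ) →+ (Fin r → ℤ) := Finsupp.coeFnAddHom
  refine ⟨r, co.comp ((AddMonoidHom.fst _ _).comp E.toAddMonoidHom), ?_, ?_⟩
  · have : LinearIndependent ℤ (fun i : Fin r => E.symm (Finsupp.single i 1, 0)) := by
      have h1 : LinearIndependent ℤ (fun i : Fin r => (Finsupp.single i (1 : ℤ))) :=
        Finsupp.basisSingleOne.linearIndependent
      let φ : (Fin r →₀ ℤ) →ₗ[ℤ] H :=
        (E.symm.toAddMonoidHom.comp (AddMonoidHom.inl _ _)).toIntLinearMap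
      have h2 := h1.map' φ (by
        rw [LinearMap.ker_eq_bot]
        intro a b hab
        have := E.symm.injective hab
        simpa using this)
      exact h2
    exact Module.le_rank_iff.mpr ⟨_, this⟩
  · intro S hS
    have h1 : ((co ⁻¹' S) ×ˢ (Set.univ : Set (DirectSum ι fun i => ZMod (p i ^ e i)))).Finite :=
      (hS.preimage DFunLike.coe_injective.injOn).prod Set.finite_univ
    refine (h1.preimage (f := E) E.injective.injOn).subset ?_
    intro a ha
    exact ⟨ha, trivial⟩

theorem asdimLE_of_rank_le {A : Type*} [AddCommGroup A] [MetricSpace A]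
    (hinv : ∀ g x y : A, dist (g + x) (g + y) = dist x y)
    (hproper : ∀ (x : A) (r : ℝ), {y : A | dist x y ≤ r}.Finite) (n : ℕ)
    (h : Module.rank ℤ A ≤ n) : AsdimLE A n := by
  classical
  intro d hd
  let H : AddSubgroup A := AddSubgroup.closure {y : A | dist 0 y ≤ d}
  have hfin := hproper 0 d
  have : Finite {y : A | dist 0 y ≤ d} := hfin
  have : AddGroup.FG H := AddGroup.closure_finite_fg _
  obtain ⟨r, π, hr, hπ⟩ := exists_hom_of_fg H
  have hrn : r ≤ n := by
    have h1 : Module.rank ℤ H ≤ Module.rank ℤ A :=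
      LinearMap.rank_le_of_injective (H.subtype.toIntLinearMap) H.subtype_injective
    exact_mod_cast hr.trans (h1.trans h)
  have hball : ∀ a b : A, dist a b ≤ d → b - a ∈ H := by
    intro a b hab
    rw [dist_eq_zero_sub hinv] at hab
    exact AddSubgroup.subset_closure hab
  -- scale s
  have hfinB : {w : H | dist (0 : A) w ≤ d}.Finite := hfin.preimage Subtype.val_injective.injOn
  obtain ⟨s, hs, hsb⟩ : ∃ s : ℤ, 0 < s ∧ ∀ w : H, dist (0 : A) w ≤ d → ∀ i, |π w i| ≤ s := by
    obtain ⟨M, hM⟩ := (hfinB.image (fun w => ∑ i, |π w i|)).bddAbove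
    refine ⟨max M 1, by positivity, fun w hw i => ?_⟩
    have h1 : ∑ i, |π w i| ≤ M := hM ⟨w, hw, rfl⟩
    have h2 : |π w i| ≤ ∑ i, |π w i| :=
      Finset.single_le_sum (f := fun i => |π w i|) (fun i _ => abs_nonneg _) (Finset.mem_univ i)
    exact (h2.trans h1).trans (le_max_left _ _)
  set L : ℤ := ((n : ℤ) + 1) * s with hLdef
  have hL : 0 < L := by positivity
  -- coset representatives
  let rep : A → A := fun a => (QuotientAddGroup.mk a : A ⧸ H).out
  have hrep : ∀ a, a - rep a ∈ H := by
    intro a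
    have : (QuotientAddGroup.mk (rep a) : A ⧸ H) = QuotientAddGroup.mk a := Quotient.out_eq' _
    rw [QuotientAddGroup.eq] at this
    simpa [sub_eq_neg_add] using this
  let hh : A → H := fun a => ⟨a - rep a, hrep a⟩
  let Z : Fin (n + 1) → (A ⧸ H) × (Fin r → ℤ) → Set A := fun j Cz =>
    {a | (QuotientAddGroup.mk a : A ⧸ H) = Cz.1 ∧ (∀ i, (π (hh a) i - j * s) % L < L - s) ∧
      ∀ i, (π (hh a) i - j * s) / L = Cz.2 i}
  have hsame : ∀ a b : A, (QuotientAddGroup.mk a : A ⧸ H) = QuotientAddGroup.mk b →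
      ((hh b - hh a : H) : A) = b - a := by
    intro a b hab
    have : rep a = rep b := by simp only [rep, hab]
    simp [hh, this]
  -- bound R
  have hfinS : (Set.pi Set.univ (fun _ : Fin r => Set.Icc (-L) L)).Finite :=
    Set.Finite.pi fun _ => Set.finite_Icc _ _
  obtain ⟨R, hR⟩ := ((hπ _ hfinS).image (fun w : H => dist (0 : A) w)).bddAbove
  refine ⟨max R 1, by positivity, fun j => Set.range (Z j), ?_, ?_, ?_⟩
  · rintro j _ ⟨⟨C, z⟩, rfl⟩ a ha b hb
    have hab := ha.1.trans hb.1.symm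
    rw [dist_eq_zero_sub hinv, ← hsame a b hab]
    refine le_trans (hR ⟨hh b - hh a, ?_, rfl⟩) (le_max_left _ _)
    intro i _
    have e1 := ha.2.2 i
    have e2 := hb.2.2 i
    have a1 := Int.emod_nonneg (π (hh a) i - j * s) hL.ne'
    have a2 := Int.emod_nonneg (π (hh b) i - j * s) hL.ne'
    have a3 := Int.emod_lt_of_pos (π (hh a) i - j * s) hL
    have a4 := Int.emod_lt_of_pos (π (hh b) i - j * s) hL
    have b1 := Int.mul_ediv_add_emod (π (hh a) i - j * s) L
    have b2 := Int.mul_ediv_add_emod (π (hh b) i - j * s) L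
    rw [e1] at b1
    rw [e2] at b2
    rw [map_sub, Pi.sub_apply]
    constructor <;> linarith
  · rintro j _ ⟨⟨C, z⟩, rfl⟩ _ ⟨⟨C', z'⟩, rfl⟩ hne a ha b hb
    by_contra hc
    push Not at hc
    apply hne
    have hab : (QuotientAddGroup.mk a : A ⧸ H) = QuotientAddGroup.mk b := by
      rw [QuotientAddGroup.eq]
      simpa [sub_eq_neg_add] using hball a b hc
    have hC : C = C' := ha.1.symm.trans (hab.trans hb.1)
    have hz : z = z' := by
      funext i
      have hza : (π (hh a) i - j * s) / L = z i := ha.2.2 i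
      have hzb : (π (hh b) i - j * s) / L = z' i := hb.2.2 i
      rw [← hza, ← hzb]
      apply good_far L s _ _ hL (ha.2.1 i) (hb.2.1 i)
      have h1 := hsb (hh b - hh a) (by
        rw [hsame a b hab, ← dist_eq_zero_sub hinv]; exact hc) i
      rw [map_sub, Pi.sub_apply] at h1
      convert h1 using 2
      ring
    rw [hC, hz]
  · rw [Set.eq_univ_iff_forall]
    intro a
    have : ∃ j : Fin (n + 1), ∀ i, (π (hh a) i - j * s) % L < L - s := by
      by_contra! hc
      choose f hf using hc
      have hfi : Function.Injective f := by
        intro j j' hjj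
        have h1 := hf j
        have h2 := hf j'
        rw [← hjj] at h2
        exact bad_unique n s hs _ j j' h1 h2
      have := Fintype.card_le_of_injective f hfi
      simp at this
      omega
    obtain ⟨j, hj⟩ := this
    rw [Set.mem_iUnion]
    exact ⟨j, Z j (QuotientAddGroup.mk a, fun i => (π (hh a) i - j * s) / L), ⟨_, rfl⟩,
      rfl, hj, fun i => rfl⟩

theorem asdim_eq_rank {A : Type*} [AddCommGroup A] [MetricSpace A]
    (hinv : ∀ g x y : A, dist (g + x) (g + y) = dist x y)
    (hproper : ∀ (x : A) (r : ℝ), {y : A | dist x y ≤ r}.Finite) :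
    asdim A = Cardinal.toENat (Module.rank ℤ A) := by
  have hiff : ∀ n : ℕ, AsdimLE A n ↔ Cardinal.toENat (Module.rank ℤ A) ≤ n := by
    intro n
    rw [Cardinal.toENat_le_natCast]
    exact ⟨rank_le_of_asdimLE hinv hproper n, asdimLE_of_rank_le hinv hproper n⟩
  unfold asdim
  apply le_antisymm
  · refine ENat.forall_natCast_le_iff_le.mp ?_ |> fun h => h
    intro m hm
    by_contra hc
    have hlt := not_le.mp hc
    obtain ⟨k, hk⟩ := ENat.ne_top_iff_exists.mp hlt.ne_top
    rw [← hk] at hc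
    exact hc (hm.trans (sInf_le ⟨k, rfl, (hiff k).mpr hk.symm.le⟩))
  · apply le_sInf
    rintro _ ⟨n, rfl, hn⟩
    exact (hiff n).mp hn

universe uA uB uC

theorem asdim_exact {B : Type uB} {A : Type uA} {C : Type uC}
    [AddCommGroup A] [AddCommGroup B] [AddCommGroup C]
    [MetricSpace A] [MetricSpace B] [MetricSpace C]
    (hinvA : ∀ g x y : A, dist (g + x) (g + y) = dist x y)
    (hproperA : ∀ (x : A) (r : ℝ), {y : A | dist x y ≤ r}.Finite)
    (hinvB : ∀ g x y : B, dist (g + x) (g + y) = dist x y)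
    (hproperB : ∀ (x : B) (r : ℝ), {y : B | dist x y ≤ r}.Finite)
    (hinvC : ∀ g x y : C, dist (g + x) (g + y) = dist x y)
    (hproperC : ∀ (x : C) (r : ℝ), {y : C | dist x y ≤ r}.Finite)
    (f : B →+ A) (g : A →+ C)
    (hf : Function.Injective f) (hg : Function.Surjective g)
    (hexact : ∀ a : A, g a = 0 ↔ a ∈ Set.range f) :
    asdim A = asdim B + asdim C := by
  rw [asdim_eq_rank hinvA hproperA, asdim_eq_rank hinvB hproperB, asdim_eq_rank hinvC hproperC]
  let f' := f.toIntLinearMap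
  let g' := g.toIntLinearMap
  have h1 := rank_quotient_add_rank_of_isDomain (LinearMap.range f')
  have hfr : LinearMap.range f' = LinearMap.ker g' := by
    ext a
    exact (hexact a).symm
  have e1 := (LinearEquiv.ofInjective f' hf).lift_rank_eq
  have e2 := ((Submodule.quotEquivOfEq _ _ hfr).trans
    (g'.quotKerEquivOfSurjective hg)).lift_rank_eq
  have e1' := congrArg Cardinal.toENat e1
  have e2' := congrArg Cardinal.toENat e2
  simp only [Cardinal.toENat_lift] at e1' e2'
  rw [← h1, map_add, e1', e2', add_comm]

theorem asdim_of_short_exact_sequence {B A C : Type*}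
    [AddCommGroup A] [AddCommGroup B] [AddCommGroup C]
    [Countable A] [Countable B] [Countable C]
    [MetricSpace A] [MetricSpace B] [MetricSpace C]
    (hinvA : ∀ g x y : A, dist (g + x) (g + y) = dist x y)
    (hproperA : ∀ (x : A) (r : ℝ), {y : A | dist x y ≤ r}.Finite)
    (hinvB : ∀ g x y : B, dist (g + x) (g + y) = dist x y)
    (hproperB : ∀ (x : B) (r : ℝ), {y : B | dist x y ≤ r}.Finite)
    (hinvC : ∀ g x y : C, dist (g + x) (g + y) = dist x y)
    (hproperC : ∀ (x : C) (r : ℝ), {y : C | dist x y ≤ r}.Finite)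
    (f : B →+ A) (g : A →+ C)
    (hf : Function.Injective f) (hg : Function.Surjective g)
    (hexact : ∀ a : A, g a = 0 ↔ a ∈ Set.range f) :
    asdim A = asdim B + asdim C ∧ asdim (B × C) = asdim B + asdim C := by
  refine ⟨asdim_exact hinvA hproperA hinvB hproperB hinvC hproperC f g hf hg hexact, ?_⟩
  refine asdim_exact ?_ ?_ hinvB hproperB hinvC hproperC (AddMonoidHom.inl B C)
    (AddMonoidHom.snd B C) ?_ ?_ ?_
  · intro g x y
    simp [Prod.dist_eq, hinvB, hinvC]
  · intro x r
    refine ((hproperB x.1 r).prod (hproperC x.2 r)).subset ?_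
    intro y hy
    simpa [Prod.dist_eq] using hy
  · intro a b hab
    simpa using hab
  · intro c
    exact ⟨(0, c), rfl⟩
  · rintro ⟨b, c⟩
    simp [eq_comm]
end
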